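/- arXiv:math/0404192 — 2 statements merged into one kernel-verified Lean document; each statement's English description precedes it below -/
import Mathlib

section
/- For sets $K,D\subseteq\mathbb{R}^n$ let $N(K,D)$ be the minimal number $N$ of points $x_1,\dots,x_N\in\mathbb{R}^n$ with $K\subseteq\bigcup_j(x_j+D)$ ($N(K,D)=\infty$ if there is no such finite $N$). A closed octant is a set $\{x : (x_i-z_i)\theta_i\ge 0 \text{ for all } i\}$ with $z\in\mathbb{R}^n$ and $\theta\in\{-1,1\}^n$, and the coordinate convex hull $\mathrm{cconv}(A)$ is the set obtained from $\mathbb{R}^n$ by removing all closed octants disjoint from $A$ (likewise in $\mathbb{R}^\sigma$ for $\sigma\subseteq\{1,\dots,n\}$). An integer cell in $\mathbb{R}^\sigma$ is a set $a+[0,1]^\sigma$ with $a\in\mathbb{Z}^\sigma$. The cell content of a nonempty set $A\subseteq\mathbb{R}^n$ is $$\Sigma(A)=\sum_P \#\{\text{integer cells contained in } \mathrm{cconv}(PA)\}\in[1,\infty],$$ where the sum is over all $2^n$ coordinate projections $P:\mathbb{R}^n\to\mathbb{R}^\sigma$, $\sigma\subseteq\{1,\dots,n\}$, and the summand for the $0$-dimensional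 projection is set equal to $1$. There is an absolute constant $C>0$ such that the following holds. Let $A$ be a set in $\mathbb{R}^n$ with $N(A,Q)\ge 2$, where $Q=[0,1]^n$, and let $0<\varepsilon\le 1$. Then $$N(A,Q)\le \Sigma(C\varepsilon^{-1}A)^M,\qquad M=4\Bigl(\log\bigl(e+n/\log N(A,Q)\bigr)\Bigr)^{\varepsilon}.$$ (If $N(A,Q)=\infty$, then $n/\log N(A,Q)$ is read as $0$.) -/
open scoped ENNReal Pointwise

/-- The closed octant in `ℝ^n` with vertex `z` and signs `θ`. -/
def octant {n : ℕ} (θ z : Fin n → ℝ) : Set (Fin n → ℝ) :=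
  {x | ∀ i, 0 ≤ (x i - z i) * θ i}

/-- The coordinate convex hull of `A`: what remains of `ℝ^n` after removing all closed
octants disjoint from `A`; equivalently, the points `x` such that every octant containing `x`
intersects `A`. -/
def cconv {n : ℕ} (A : Set (Fin n → ℝ)) : Set (Fin n → ℝ) :=
  {x | ∀ θ z : Fin n → ℝ, (∀ i, θ i = 1 ∨ θ i = -1) → x ∈ octant θ z →
    (octant θ z ∩ A).Nonempty}

/-- The coordinate projection of `ℝ^n` onto `ℝ^σ`, where `ℝ^σ` is the coordinate subspace of `ℝ^n`
of points vanishing off `σ`. An octant of `ℝ^n` that meets this subspace meets it in an octant of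
`ℝ^σ`, and all octants of `ℝ^σ` arise so; hence on points of `ℝ^σ` the hull `cconv` of a subset of
`ℝ^σ` is the same whether formed in `ℝ^σ` or in `ℝ^n`. -/
def coordProj {n : ℕ} (σ : Finset (Fin n)) (x : Fin n → ℝ) : Fin n → ℝ :=
  fun i => if i ∈ σ then x i else 0

/-- The integer cell `a + [0,1]^σ` in `ℝ^σ` (realized inside `ℝ^n` with zero coordinates
off `σ`). -/
def intCell {n : ℕ} (σ : Finset (Fin n)) (a : Fin n → ℤ) : Set (Fin n → ℝ) :=
  {x | (∀ i ∈ σ, (a i : ℝ) ≤ x i ∧ x i ≤ (a i : ℝ) + 1) ∧ ∀ i ∉ σ, x i = 0}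

/-- The cell content `Σ(A)`: the total number of integer cells contained in the coordinate
convex hulls of all coordinate projections of `A` (the summand for `σ = ∅` equals `1`
exactly when `A` is nonempty). -/
noncomputable def cellContent {n : ℕ} (A : Set (Fin n → ℝ)) : ℝ≥0∞ :=
  ∑ σ : Finset (Fin n),
    (({a : Fin n → ℤ | (∀ i ∉ σ, a i = 0) ∧ intCell σ a ⊆ cconv (coordProj σ '' A)}.encard :
      ℕ∞) : ℝ≥0∞)

/-- The covering number `N(K,D)`: the minimal number of translates of `D` needed to cover
`K`. -/
noncomputable def coveringNumber {n : ℕ} (K D : Set (Fin n → ℝ)) : ℕ∞ :=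
  ⨅ (m : ℕ) (_ : ∃ x : Fin m → Fin n → ℝ, K ⊆ ⋃ j, (fun y => x j + y) '' D), (m : ℕ∞)

/-- The unit cube `[0,1]^n`. -/
def unitCube (n : ℕ) : Set (Fin n → ℝ) := {x | ∀ i, 0 ≤ x i ∧ x i ≤ 1}

/-- The set of all integer cells, over all coordinate projections, that are counted by
`cellContent A`. -/
def cellSet {n : ℕ} (A : Set (Fin n → ℝ)) : Set (Finset (Fin n) × (Fin n → ℤ)) :=
  {p | (∀ i ∉ p.1, p.2 i = 0) ∧ intCell p.1 p.2 ⊆ cconv (coordProj p.1 '' A)}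

theorem cellContent_eq_encard {n : ℕ} (A : Set (Fin n → ℝ)) :
    cellContent A = ((cellSet A).encard : ℝ≥0∞) := by
  set c : Finset (Fin n) → Set (Fin n → ℤ) := fun σ =>
    {a | (∀ i ∉ σ, a i = 0) ∧ intCell σ a ⊆ cconv (coordProj σ '' A)} with hc
  have hU : cellSet A = ⋃ σ, Prod.mk σ '' c σ := by
    ext ⟨σ, a⟩
    simp [cellSet, hc]
  have hd : Pairwise (Function.onFun Disjoint fun σ => Prod.mk σ '' c σ) := by
    intro σ τ hne
    rw [Function.onFun, Set.disjoint_left]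
    rintro _ ⟨a, -, rfl⟩ ⟨b, -, h⟩
    exact hne (congrArg Prod.fst h).symm
  have hinj : ∀ σ, (Prod.mk σ '' c σ).encard = (c σ).encard := fun σ =>
    (Prod.mk_right_injective σ).encard_image _
  rw [hU, Set.encard_iUnion_of_finite hd, finsum_eq_sum_of_fintype]
  simp only [hinj]
  unfold cellContent
  exact (map_sum ENat.toENNRealRingHom (fun σ => (c σ).encard) Finset.univ).symm

theorem cconv_mono {n : ℕ} {A B : Set (Fin n → ℝ)} (h : A ⊆ B) : cconv A ⊆ cconv B :=
  fun _ hx θ z hθ hz => (hx θ z hθ hz).mono (Set.inter_subset_inter_right _ h)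

theorem cellSet_mono {n : ℕ} {A B : Set (Fin n → ℝ)} (h : A ⊆ B) : cellSet A ⊆ cellSet B :=
  fun _ hp => ⟨hp.1, hp.2.trans (cconv_mono (Set.image_mono h))⟩

theorem cellContent_mono {n : ℕ} {A B : Set (Fin n → ℝ)} (h : A ⊆ B) :
    cellContent A ≤ cellContent B := by
  rw [cellContent_eq_encard, cellContent_eq_encard]
  exact_mod_cast Set.encard_le_encard (cellSet_mono h)

theorem one_le_cellContent {n : ℕ} {A : Set (Fin n → ℝ)} (h : A.Nonempty) :
    1 ≤ cellContent A := by
  rw [cellContent_eq_encard]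
  have : ((∅ : Finset (Fin n)), (0 : Fin n → ℤ)) ∈ cellSet A := by
    obtain ⟨a, ha⟩ := h
    refine ⟨fun _ _ => rfl, fun x hx θ z _ hxz => ⟨coordProj ∅ a, ?_, a, ha, rfl⟩⟩
    have : coordProj ∅ a = x := by
      funext i
      simp [coordProj, hx.2 i (by simp)]
    rwa [this]
  have h1 : (1 : ℕ∞) ≤ (cellSet A).encard := Set.one_le_encard_iff_nonempty.2 ⟨_, this⟩
  exact_mod_cast h1

theorem self_mem_octant {n : ℕ} (θ x : Fin n → ℝ) : x ∈ octant θ x := fun i => by simp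

theorem cellSet_upper_le {n : ℕ} {B : Set (Fin n → ℝ)} {i : Fin n} {a : ℤ}
    (hB : ∀ x ∈ B, x i ≤ a) {p : Finset (Fin n) × (Fin n → ℤ)} (hp : p ∈ cellSet B)
    (hi : i ∈ p.1) : p.2 i + 1 ≤ a := by
  have hx : (fun j => if j ∈ p.1 then (p.2 j : ℝ) + 1 else 0) ∈ intCell p.1 p.2 :=
    ⟨fun j hj => by simp [hj], fun j hj => by simp [hj]⟩
  obtain ⟨_, hy, b, hb, rfl⟩ := hp.2 hx (fun _ => 1) _ (fun _ => Or.inl rfl)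
    (self_mem_octant _ _)
  have h1 := hy i
  have h2 := hB b hb
  simp only [coordProj, hi, if_true, mul_one] at h1
  have : (p.2 i : ℝ) + 1 ≤ a := by linarith
  exact_mod_cast this

theorem le_cellSet_lower {n : ℕ} {B : Set (Fin n → ℝ)} {i : Fin n} {a : ℤ}
    (hB : ∀ x ∈ B, (a : ℝ) ≤ x i) {p : Finset (Fin n) × (Fin n → ℤ)} (hp : p ∈ cellSet B)
    (hi : i ∈ p.1) : a ≤ p.2 i := by
  have hx : (fun j => if j ∈ p.1 then (p.2 j : ℝ) else 0) ∈ intCell p.1 p.2 :=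
    ⟨fun j hj => by simp [hj], fun j hj => by simp [hj]⟩
  obtain ⟨_, hy, b, hb, rfl⟩ := hp.2 hx (fun _ => -1) _ (fun _ => Or.inr rfl)
    (self_mem_octant _ _)
  have h1 := hy i
  have h2 := hB b hb
  simp only [coordProj, hi, if_true] at h1
  have : (a : ℝ) ≤ p.2 i := by linarith
  exact_mod_cast this

/-- A cell common to the hulls of two sets on either side of a unit slab extends across the
slab. -/
theorem insert_update_mem_cellSet {n : ℕ} {A B₁ B₂ : Set (Fin n → ℝ)} {i : Fin n} {a : ℤ}
    (h₁ : B₁ ⊆ A) (h₂ : B₂ ⊆ A) (hlo : ∀ x ∈ B₁, x i ≤ a) (hhi : ∀ x ∈ B₂, (a : ℝ) + 1 ≤ x i)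
    {σ : Finset (Fin n)} {c : Fin n → ℤ} (hi : i ∉ σ) (hc₁ : (σ, c) ∈ cellSet B₁)
    (hc₂ : (σ, c) ∈ cellSet B₂) : (insert i σ, Function.update c i a) ∈ cellSet A := by
  refine ⟨fun j hj => ?_, fun x hx θ z hθ hxz => ?_⟩
  · simp only [Finset.mem_insert, not_or] at hj
    simpa [Function.update_of_ne hj.1] using hc₁.1 j hj.2
  have hne : ∀ j ∈ σ, j ≠ i := fun j hj h => hi (h ▸ hj)
  have hxi := hx.1 i (Finset.mem_insert_self _ _)
  simp only [Function.update_self] at hxi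
  have hy : Function.update x i 0 ∈ intCell σ c := by
    refine ⟨fun j hj => ?_, fun j hj => ?_⟩
    · have := hx.1 j (Finset.mem_insert_of_mem hj)
      simpa [Function.update_of_ne (hne j hj)] using this
    · by_cases hji : j = i
      · simp [hji]
      · rw [Function.update_of_ne hji]
        exact hx.2 j (by simp [hji, hj])
  have hyz : Function.update x i 0 ∈ octant θ (Function.update z i 0) := by
    intro j
    by_cases hji : j = i
    · simp [hji]
    · simpa [Function.update_of_ne hji] using hxz j
  have key : ∀ b ∈ A, coordProj σ b ∈ octant θ (Function.update z i 0) →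
      0 ≤ (b i - z i) * θ i → (octant θ z ∩ coordProj (insert i σ) '' A).Nonempty := by
    intro b hb hbo hbi
    refine ⟨coordProj (insert i σ) b, fun j => ?_, b, hb, rfl⟩
    by_cases hji : j = i
    · simpa [hji, coordProj] using hbi
    · have := hbo j
      simpa [Function.update_of_ne hji, coordProj, hji] using this
  have hzi := hxz i
  rcases hθ i with hθi | hθi
  · obtain ⟨_, hb, b, hbB, rfl⟩ := hc₂.2 hy θ _ hθ hyz
    refine key b (h₂ hbB) hb ?_
    have := hhi b hbB
    rw [hθi] at hzi ⊢
    linarith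
  · obtain ⟨_, hb, b, hbB, rfl⟩ := hc₁.2 hy θ _ hθ hyz
    refine key b (h₁ hbB) hb ?_
    have := hlo b hbB
    rw [hθi] at hzi ⊢
    linarith

/-- The cell content is superadditive over subsets lying on either side of a unit slab. -/
theorem cellContent_add_le {n : ℕ} {A B₁ B₂ : Set (Fin n → ℝ)} {i : Fin n} {a : ℤ}
    (h₁ : B₁ ⊆ A) (h₂ : B₂ ⊆ A) (hlo : ∀ x ∈ B₁, x i ≤ a)
    (hhi : ∀ x ∈ B₂, (a : ℝ) + 1 ≤ x i) :
    cellContent B₁ + cellContent B₂ ≤ cellContent A := by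
  have hhi' : ∀ x ∈ B₂, ((a + 1 : ℤ) : ℝ) ≤ x i := by
    push_cast
    exact hhi
  set φ : Finset (Fin n) × (Fin n → ℤ) → Finset (Fin n) × (Fin n → ℤ) :=
    fun p => (insert i p.1, Function.update p.2 i a) with hφ
  have hmem : ∀ p ∈ cellSet B₁ ∩ cellSet B₂, i ∉ p.1 := fun p hp hi => by
    have e1 := cellSet_upper_le hlo hp.1 hi
    have e2 := le_cellSet_lower hhi' hp.2 hi
    omega
  have hinj : Set.InjOn φ (cellSet B₁ ∩ cellSet B₂) := by
    rintro ⟨σ, c⟩ hp ⟨τ, d⟩ hq h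
    have hσ := hmem _ hp
    have hτ := hmem _ hq
    simp only [hφ, Prod.mk.injEq] at h hσ hτ ⊢
    refine ⟨?_, funext fun j => ?_⟩
    · rw [← Finset.erase_insert hσ, h.1, Finset.erase_insert hτ]
    · by_cases hj : j = i
      · rw [hj]
        exact (hp.1.1 i hσ).trans (hq.1.1 i hτ).symm
      · simpa [Function.update_of_ne hj] using congrFun h.2 j
  have hdisj : Disjoint (cellSet B₁ ∪ cellSet B₂) (φ '' (cellSet B₁ ∩ cellSet B₂)) := by
    rw [Set.disjoint_right]
    rintro _ ⟨p, -, rfl⟩ (h | h)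
    · have := cellSet_upper_le hlo h (Finset.mem_insert_self _ _)
      simp [hφ] at this
    · have := le_cellSet_lower hhi' h (Finset.mem_insert_self _ _)
      simp [hφ] at this
  have hsub : (cellSet B₁ ∪ cellSet B₂) ∪ φ '' (cellSet B₁ ∩ cellSet B₂) ⊆ cellSet A := by
    refine Set.union_subset (Set.union_subset (cellSet_mono h₁) (cellSet_mono h₂)) ?_
    rintro _ ⟨p, hp, rfl⟩
    exact insert_update_mem_cellSet h₁ h₂ hlo hhi (hmem p hp) hp.1 hp.2
  have hle := Set.encard_le_encard hsub
  rw [Set.encard_union_eq hdisj, hinj.encard_image, Set.encard_union_add_encard_inter] at hle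
  simp only [cellContent_eq_encard]
  exact_mod_cast hle

theorem sum_Icc_pow_natAbs_le {q : ℝ} (hq0 : 0 ≤ q) (hq : q ≤ 1 / 2) (B : ℕ) :
    ∑ j ∈ Finset.Icc (-(B : ℤ)) B, q ^ j.natAbs ≤ 1 + 4 * q - 4 * q ^ (B + 1) := by
  induction B with
  | zero => simp
  | succ B ih =>
    have hI : Finset.Icc (-((B + 1 : ℕ) : ℤ)) ((B + 1 : ℕ) : ℤ) =
        insert (-((B + 1 : ℕ) : ℤ)) (insert ((B + 1 : ℕ) : ℤ) (Finset.Icc (-(B : ℤ)) B)) := by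
      ext j
      simp only [Finset.mem_Icc, Finset.mem_insert]
      omega
    rw [hI, Finset.sum_insert, Finset.sum_insert]
    · rw [Int.natAbs_neg, Int.natAbs_natCast]
      have : q ^ (B + 1 + 1) ≤ 1 / 2 * q ^ (B + 1) := by
        rw [pow_succ' q (B + 1)]
        exact mul_le_mul_of_nonneg_right hq (by positivity)
      linarith
    · simp
    · simp only [Finset.mem_insert, Finset.mem_Icc]
      omega

theorem sum_prod_pow_natAbs_le {α : Type*} {n : ℕ} (S : Finset α) (v : α → Fin n → ℤ)
    (hv : Set.InjOn v S) {q : ℝ} (hq0 : 0 ≤ q) (hq : q ≤ 1 / 2) :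
    ∑ x ∈ S, ∏ i, q ^ (v x i).natAbs ≤ (1 + 4 * q) ^ n := by
  classical
  obtain ⟨B, hB⟩ : ∃ B : ℕ, ∀ x ∈ S, ∀ i, (v x i).natAbs ≤ B :=
    ⟨∑ x ∈ S, ∑ i, (v x i).natAbs, fun x hx i =>
      (Finset.single_le_sum (f := fun i => (v x i).natAbs) (fun _ _ => Nat.zero_le _)
        (Finset.mem_univ i)).trans
      (Finset.single_le_sum (f := fun x => ∑ i, (v x i).natAbs) (fun _ _ => Nat.zero_le _) hx)⟩
  calc ∑ x ∈ S, ∏ i, q ^ (v x i).natAbs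
      = ∑ w ∈ S.image v, ∏ i, q ^ (w i).natAbs :=
        (Finset.sum_image (f := fun w : Fin n → ℤ => ∏ i, q ^ (w i).natAbs) hv).symm
    _ ≤ ∑ w ∈ Fintype.piFinset fun _ : Fin n => Finset.Icc (-(B : ℤ)) B,
          ∏ i, q ^ (w i).natAbs := by
        refine Finset.sum_le_sum_of_subset_of_nonneg ?_ fun _ _ _ => by positivity
        intro w hw
        obtain ⟨x, hx, rfl⟩ := Finset.mem_image.1 hw
        refine Fintype.mem_piFinset.2 fun i => Finset.mem_Icc.2 ?_
        have := hB x hx i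
        omega
    _ = ∏ _i : Fin n, ∑ j ∈ Finset.Icc (-(B : ℤ)) B, q ^ j.natAbs :=
        (Finset.prod_univ_sum (fun _ : Fin n => Finset.Icc (-(B : ℤ)) B)
          fun _ j => q ^ j.natAbs).symm
    _ = (∑ j ∈ Finset.Icc (-(B : ℤ)) B, q ^ j.natAbs) ^ n := by
        rw [Finset.prod_const, Finset.card_univ, Fintype.card_fin]
    _ ≤ (1 + 4 * q) ^ n := by
        refine pow_le_pow_left₀ (Finset.sum_nonneg fun _ _ => by positivity) ?_ n
        have := sum_Icc_pow_natAbs_le hq0 hq B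
        have : 0 ≤ q ^ (B + 1) := by positivity
        linarith

/-- The Gibbs inequality for an injective integer-valued coding, with two-sided geometric weights. -/
theorem card_mul_log_card_le {α : Type*} {n : ℕ} (S : Finset α) (v : α → Fin n → ℤ)
    (hv : Set.InjOn v S) {q : ℝ} (hq0 : 0 < q) (hq : q ≤ 1 / 2) :
    (S.card : ℝ) * Real.log S.card ≤
      S.card * (n * (4 * q)) + -Real.log q * ∑ x ∈ S, ∑ i, ((v x i).natAbs : ℝ) := by
  rcases S.eq_empty_or_nonempty with rfl | hS
  · simp
  have hN : (0 : ℝ) < S.card := by exact_mod_cast hS.card_pos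
  have hZ := sum_prod_pow_natAbs_le S v hv hq0.le hq
  have hZ0 : (0 : ℝ) < (1 + 4 * q) ^ n := by positivity
  have hlogZ : Real.log ((1 + 4 * q) ^ n) ≤ n * (4 * q) := by
    rw [Real.log_pow]
    refine mul_le_mul_of_nonneg_left ?_ (Nat.cast_nonneg n)
    have := Real.log_le_sub_one_of_pos (show (0 : ℝ) < 1 + 4 * q by positivity)
    linarith
  have hpt : ∀ x ∈ S, Real.log S.card - n * (4 * q) + Real.log q * ∑ i, ((v x i).natAbs : ℝ) ≤
      S.card / (1 + 4 * q) ^ n * ∏ i, q ^ (v x i).natAbs - 1 := by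
    intro x _
    have hp : 0 < ∏ i, q ^ (v x i).natAbs := Finset.prod_pos fun _ _ => by positivity
    have h := Real.log_le_sub_one_of_pos (mul_pos (div_pos hN hZ0) hp)
    rw [Real.log_mul (div_pos hN hZ0).ne' hp.ne', Real.log_div hN.ne' hZ0.ne',
      Real.log_prod (fun i _ => by positivity)] at h
    simp only [Real.log_pow] at h hlogZ
    rw [← Finset.sum_mul] at h
    linarith [mul_comm (Real.log q) (∑ i, ((v x i).natAbs : ℝ))]
  have hsum := Finset.sum_le_sum hpt
  rw [Finset.sum_sub_distrib, ← Finset.mul_sum, Finset.sum_add_distrib, Finset.sum_const,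
    Finset.sum_const, ← Finset.mul_sum, nsmul_eq_mul, nsmul_eq_mul] at hsum
  have : (S.card : ℝ) / (1 + 4 * q) ^ n * ∑ x ∈ S, ∏ i, q ^ (v x i).natAbs ≤ S.card := by
    calc _ ≤ (S.card : ℝ) / (1 + 4 * q) ^ n * (1 + 4 * q) ^ n :=
          mul_le_mul_of_nonneg_left hZ (by positivity)
      _ = S.card := by field_simp
  nlinarith

theorem sum_natAbs_le_of_tail {α : Type*} (S : Finset α) (f : α → ℕ) {q : ℝ} (hq0 : 0 ≤ q)
    (hq : q ≤ 1 / 2)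
    (h : ∀ j, 1 ≤ j → ((S.filter fun x => j ≤ f x).card : ℝ) ≤ 2 * q ^ j * S.card) :
    ∑ x ∈ S, (f x : ℝ) ≤ 4 * q * S.card := by
  classical
  obtain ⟨B, hB⟩ : ∃ B : ℕ, ∀ x ∈ S, f x ≤ B :=
    ⟨∑ x ∈ S, f x, fun x hx => Finset.single_le_sum (fun _ _ => Nat.zero_le _) hx⟩
  have h1 : ∀ x ∈ S, (f x : ℝ) = ∑ j ∈ Finset.range B, if j + 1 ≤ f x then (1 : ℝ) else 0 := by
    intro x hx
    rw [← Finset.sum_filter, Finset.sum_const, nsmul_eq_mul, mul_one]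
    have : (Finset.range B).filter (fun j => j + 1 ≤ f x) = Finset.range (f x) := by
      ext j
      have := hB x hx
      simp only [Finset.mem_filter, Finset.mem_range]
      omega
    rw [this, Finset.card_range]
  have hgeo : ∀ B : ℕ, ∑ j ∈ Finset.range B, q ^ (j + 1) ≤ 2 * q - 2 * q ^ (B + 1) := by
    intro B
    induction B with
    | zero => simp
    | succ B ih =>
      rw [Finset.sum_range_succ]
      have : q ^ (B + 1 + 1) ≤ 1 / 2 * q ^ (B + 1) := by
        rw [pow_succ' q (B + 1)]
        exact mul_le_mul_of_nonneg_right hq (by positivity)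
      linarith
  have hg : ∑ j ∈ Finset.range B, q ^ (j + 1) ≤ 2 * q := by
    have := hgeo B
    have : 0 ≤ q ^ (B + 1) := by positivity
    linarith
  calc ∑ x ∈ S, (f x : ℝ)
      = ∑ j ∈ Finset.range B, ((S.filter fun x => j + 1 ≤ f x).card : ℝ) := by
        rw [Finset.sum_congr rfl h1, Finset.sum_comm]
        refine Finset.sum_congr rfl fun j _ => ?_
        rw [Finset.sum_boole]
    _ ≤ ∑ j ∈ Finset.range B, 2 * q ^ (j + 1) * S.card :=
        Finset.sum_le_sum fun j _ => h (j + 1) (by omega)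
    _ = 2 * S.card * ∑ j ∈ Finset.range B, q ^ (j + 1) := by
        rw [Finset.mul_sum]
        exact Finset.sum_congr rfl fun _ _ => by ring
    _ ≤ 2 * S.card * (2 * q) := mul_le_mul_of_nonneg_left hg (by positivity)
    _ = 4 * q * S.card := by ring

/-- An injective integer-valued coding whose coordinates have geometric tails has small
cardinality. -/
theorem log_card_le_of_tail {α : Type*} {n : ℕ} (S : Finset α) (hS : S.Nonempty)
    (v : α → Fin n → ℤ) (hv : Set.InjOn v S) {q : ℝ} (hq0 : 0 < q) (hq : q ≤ 1 / 2)
    (h : ∀ i j, 1 ≤ j →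
      ((S.filter fun x => j ≤ (v x i).natAbs).card : ℝ) ≤ 2 * q ^ j * S.card) :
    Real.log S.card ≤ n * (4 * q * (1 - Real.log q)) := by
  have hN : (0 : ℝ) < S.card := by exact_mod_cast hS.card_pos
  have h1 := card_mul_log_card_le S v hv hq0 hq
  have h2 : ∑ x ∈ S, ∑ i, ((v x i).natAbs : ℝ) ≤ n * (4 * q * S.card) := by
    rw [Finset.sum_comm]
    calc _ ≤ ∑ _i : Fin n, 4 * q * (S.card : ℝ) :=
          Finset.sum_le_sum fun i _ => sum_natAbs_le_of_tail S _ hq0.le hq (h i)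
      _ = _ := by simp
  have hlq : 0 ≤ -Real.log q := by
    have := Real.log_nonpos hq0.le (by linarith)
    linarith
  have h3 := mul_le_mul_of_nonneg_left h2 hlq
  refine le_of_mul_le_mul_left ?_ hN
  calc _ ≤ _ := h1
    _ ≤ S.card * (n * (4 * q)) + -Real.log q * (n * (4 * q * S.card)) := by linarith
    _ = _ := by ring

theorem exists_median {α : Type*} (S : Finset α) (hS : S.Nonempty) (f : α → ℝ) :
    ∃ m : ℝ, ((S.filter fun x => m < f x).card : ℝ) ≤ 1 / 2 * S.card ∧
      ((S.filter fun x => f x < m).card : ℝ) ≤ 1 / 2 * S.card := by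
  classical
  have hT : (S.filter fun y => ((S.filter fun x => f y < f x).card : ℝ) ≤
      1 / 2 * S.card).Nonempty := by
    obtain ⟨y, hy, hmax⟩ := S.exists_max_image f hS
    refine ⟨y, Finset.mem_filter.2 ⟨hy, ?_⟩⟩
    rw [Finset.filter_eq_empty_iff.2 fun x hx => not_lt.2 (hmax x hx)]
    simp
  obtain ⟨y, hy, hmin⟩ := Finset.exists_min_image _ f hT
  refine ⟨f y, (Finset.mem_filter.1 hy).2, ?_⟩
  by_contra! hlt
  have hne : (S.filter fun x => f x < f y).Nonempty := by
    rw [Finset.nonempty_iff_ne_empty]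
    intro h0
    rw [h0] at hlt
    have : (0 : ℝ) ≤ S.card := Nat.cast_nonneg _
    simp at hlt
    linarith
  obtain ⟨z, hz, hmax⟩ := Finset.exists_max_image _ f hne
  have hz' := Finset.mem_filter.1 hz
  have hle : (S.filter fun x => f z < f x).card + (S.filter fun x => f x < f y).card ≤
      S.card := by
    rw [← Finset.card_union_of_disjoint]
    · exact Finset.card_le_card (Finset.union_subset (Finset.filter_subset _ _)
        (Finset.filter_subset _ _))
    · rw [Finset.disjoint_left]
      intro x hx hx'
      exact absurd (hmax x hx') (not_le.2 (Finset.mem_filter.1 hx).2)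
  have hle' : ((S.filter fun x => f z < f x).card : ℝ) +
      ((S.filter fun x => f x < f y).card : ℝ) ≤ S.card := by exact_mod_cast hle
  have := hmin z (Finset.mem_filter.2 ⟨hz'.1, by linarith⟩)
  linarith [hz'.2]

/-- If no gap of width `δ` in the values of `f` splits `S` efficiently, then the upper tails of `f`
decay doubly exponentially. -/
theorem card_tail_le {α : Type*} (S : Finset α) (hS : S.Nonempty) (f : α → ℝ) {M δ m : ℝ}
    (hM : 1 ≤ M)
    (hns : ∀ t, (S.filter fun x => f x ≤ t).Nonempty → (S.filter fun x => t + δ ≤ f x).Nonempty →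
      ((S.filter fun x => f x ≤ t).card : ℝ) ^ M⁻¹ +
        ((S.filter fun x => t + δ ≤ f x).card : ℝ) ^ M⁻¹ < (S.card : ℝ) ^ M⁻¹)
    (hm : ((S.filter fun x => m < f x).card : ℝ) ≤ 1 / 2 * S.card) (k : ℕ) :
    ((S.filter fun x => m + k * δ < f x).card : ℝ) ≤ (1 / 2 : ℝ) ^ (M ^ k) * S.card := by
  classical
  have hN : (0 : ℝ) < S.card := by exact_mod_cast hS.card_pos
  have hM0 : 0 < M := by linarith
  induction k with
  | zero => simpa using hm
  | succ k ih =>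
    set t := m + k * δ with ht
    have hsum : ((S.filter fun x => f x ≤ t).card : ℝ) + ((S.filter fun x => t < f x).card : ℝ) =
        S.card := by
      have := S.card_filter_add_card_filter_not (fun x => f x ≤ t)
      simp only [not_le] at this
      exact_mod_cast this
    set a : ℝ := ((S.filter fun x => f x ≤ t).card : ℝ) with ha
    set b : ℝ := ((S.filter fun x => t + δ ≤ f x).card : ℝ) with hb
    set p : ℝ := ((S.filter fun x => t < f x).card : ℝ) with hp
    have hle : ((S.filter fun x => m + (k + 1 : ℕ) * δ < f x).card : ℝ) ≤ b := by
      rw [hb]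
      refine Nat.cast_le.2 (Finset.card_le_card fun x hx => ?_)
      rw [Finset.mem_filter] at hx ⊢
      refine ⟨hx.1, ?_⟩
      have := hx.2
      push_cast at this
      rw [ht]
      linarith
    refine hle.trans ?_
    have hhalf : (1 / 2 : ℝ) ^ (M ^ k) ≤ 1 / 2 := by
      have h1 : (1 : ℝ) ≤ M ^ k := one_le_pow₀ hM
      calc (1 / 2 : ℝ) ^ (M ^ k) ≤ (1 / 2 : ℝ) ^ (1 : ℝ) :=
            Real.rpow_le_rpow_of_exponent_ge (by norm_num) (by norm_num) h1
        _ = 1 / 2 := Real.rpow_one _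
    have hp_half : p ≤ 1 / 2 * S.card := ih.trans (mul_le_mul_of_nonneg_right hhalf hN.le)
    have ha0 : 0 < a := by linarith
    have hb0 : 0 ≤ b := Nat.cast_nonneg _
    have hp0 : 0 ≤ p := Nat.cast_nonneg _
    rcases hb0.eq_or_lt with hb0' | hb0'
    · rw [← hb0']
      positivity
    have hlt := hns t (Finset.card_pos.1 (by rw [ha] at ha0; exact_mod_cast ha0))
      (Finset.card_pos.1 (by rw [hb] at hb0'; exact_mod_cast hb0'))
    have hbern : a / S.card ≤ (a / S.card) ^ M⁻¹ := by
      calc a / S.card = (a / S.card) ^ (1 : ℝ) := (Real.rpow_one _).symm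
        _ ≤ _ := Real.rpow_le_rpow_of_exponent_ge (by positivity)
            ((div_le_one hN).2 (by linarith)) (inv_le_one_of_one_le₀ hM)
    have hNM : 0 < (S.card : ℝ) ^ M⁻¹ := Real.rpow_pos_of_pos hN _
    have h1 : (a / S.card) ^ M⁻¹ + (b / S.card) ^ M⁻¹ < 1 := by
      rw [Real.div_rpow ha0.le hN.le, Real.div_rpow hb0 hN.le, ← add_div, div_lt_one hNM]
      exact hlt
    have h2 : a / S.card + p / S.card = 1 := by
      rw [← add_div, hsum, div_self hN.ne']
    have h3 : (b / S.card) ^ M⁻¹ ≤ (1 / 2 : ℝ) ^ (M ^ k) := by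
      have : p / S.card ≤ (1 / 2 : ℝ) ^ (M ^ k) := (div_le_iff₀ hN).2 ih
      linarith
    have h4 : b / S.card ≤ ((1 / 2 : ℝ) ^ (M ^ k)) ^ M :=
      (Real.rpow_inv_le_iff_of_pos (by positivity) (by positivity) hM0).1 h3
    rw [← Real.rpow_mul (by norm_num), ← pow_succ] at h4
    exact (div_le_iff₀ hN).1 h4

theorem exists_finset_separated {n : ℕ} {A : Set (Fin n → ℝ)} (k : ℕ)
    (hk : (k : ℕ∞) ≤ coveringNumber A (unitCube n)) :
    ∃ S : Finset (Fin n → ℝ), (S : Set (Fin n → ℝ)) ⊆ A ∧ S.card = k ∧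
      ∀ x ∈ S, ∀ y ∈ S, x ≠ y → ∃ i, 1 / 2 < |x i - y i| := by
  classical
  induction k with
  | zero => exact ⟨∅, by simp, rfl, by simp⟩
  | succ k ih =>
    have hlt : (k : ℕ∞) < coveringNumber A (unitCube n) :=
      lt_of_lt_of_le (by exact_mod_cast Nat.lt_succ_self k) hk
    obtain ⟨S, hSA, hcard, hsep⟩ := ih hlt.le
    have hex : ∃ a ∈ A, ∀ x ∈ S, ∃ i, 1 / 2 < |a i - x i| := by
      by_contra! hcov
      refine hlt.not_ge (iInf₂_le k ⟨fun j i => ((S.equivFinOfCardEq hcard).symm j).1 i - 1 / 2, ?_⟩)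
      intro a ha
      obtain ⟨x, hx, hax⟩ := hcov a ha
      refine Set.mem_iUnion.2 ⟨S.equivFinOfCardEq hcard ⟨x, hx⟩, fun i => a i - (x i - 1 / 2),
        fun i => ?_, ?_⟩
      · have := abs_le.1 (hax i)
        constructor <;> linarith
      · funext i
        simp
    obtain ⟨a, ha, hfar⟩ := hex
    have haS : a ∉ S := fun h => by
      obtain ⟨i, hi⟩ := hfar a h
      norm_num at hi
    refine ⟨insert a S, ?_, by rw [Finset.card_insert_of_notMem haS, hcard], ?_⟩
    · rw [Finset.coe_insert]
      exact Set.insert_subset ha hSA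
    · intro x hx y hy hxy
      rcases Finset.mem_insert.1 hx with rfl | hx' <;> rcases Finset.mem_insert.1 hy with rfl | hy'
      · exact absurd rfl hxy
      · exact hfar y hy'
      · obtain ⟨i, hi⟩ := hfar x hx'
        exact ⟨i, by rwa [abs_sub_comm]⟩
      · exact hsep x hx' y hy' hxy

theorem mul_natCast_le_pow {R : ℝ} (hR : 2 ≤ R) {j : ℕ} (hj : 1 ≤ j) : R * j ≤ R ^ j := by
  induction j, hj using Nat.le_induction with
  | base => simp
  | succ j hj ih =>
    have hj' : (1 : ℝ) ≤ j := by exact_mod_cast hj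
    rw [pow_succ]
    push_cast
    have h1 := mul_le_mul_of_nonneg_right ih (show 0 ≤ R by linarith)
    have h2 : R * ((j : ℝ) + 1) ≤ R * (j * R) :=
      mul_le_mul_of_nonneg_left (by nlinarith) (by linarith)
    linarith

/-- A large separated set has a coordinate gap that splits it efficiently. -/
theorem exists_split {n : ℕ} (S : Finset (Fin n → ℝ)) (hS : S.Nonempty)
    (hsep : ∀ x ∈ S, ∀ y ∈ S, x ≠ y → ∃ i, 1 / 2 < |x i - y i|) {M : ℝ} (hM : 2 ≤ M) {K : ℕ}
    (hK : 1 ≤ K)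
    (hcard : n * (4 * (1 / 2 : ℝ) ^ (M ^ K) * (1 - Real.log ((1 / 2 : ℝ) ^ (M ^ K)))) <
      Real.log S.card) :
    ∃ (i : Fin n) (t : ℝ), (S.filter fun x => x i ≤ t).Nonempty ∧
      (S.filter fun x => t + 1 / (8 * K) ≤ x i).Nonempty ∧
      (S.card : ℝ) ^ M⁻¹ ≤ ((S.filter fun x => x i ≤ t).card : ℝ) ^ M⁻¹ +
        ((S.filter fun x => t + 1 / (8 * K) ≤ x i).card : ℝ) ^ M⁻¹ := by
  classical
  by_contra! hns
  have hK' : (0 : ℝ) < K := by exact_mod_cast hK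
  have hM1 : 1 ≤ M := by linarith
  set δ : ℝ := 1 / (8 * K) with hδ
  set R : ℝ := M ^ K with hR
  have hR2 : 2 ≤ R := hM.trans (le_self_pow₀ hM1 (by omega))
  set q : ℝ := (1 / 2 : ℝ) ^ R with hq
  have hq0 : 0 < q := Real.rpow_pos_of_pos (by norm_num) _
  have hq2 : q ≤ 1 / 2 := by
    calc q ≤ (1 / 2 : ℝ) ^ (1 : ℝ) :=
          Real.rpow_le_rpow_of_exponent_ge (by norm_num) (by norm_num) (by linarith)
      _ = 1 / 2 := Real.rpow_one _
  choose m hup hlow using fun i => exists_median S hS fun x => x i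
  have htail : ∀ i (k : ℕ),
      ((S.filter fun x => m i + k * δ < x i).card : ℝ) ≤ (1 / 2 : ℝ) ^ (M ^ k) * S.card :=
    fun i k => card_tail_le S hS (fun x => x i) hM1 (fun t h1 h2 => hns i t h1 h2) (hup i) k
  have htail' : ∀ i (k : ℕ),
      ((S.filter fun x => -m i + k * δ < -x i).card : ℝ) ≤ (1 / 2 : ℝ) ^ (M ^ k) * S.card := by
    intro i k
    refine card_tail_le S hS (fun x => -x i) hM1 (fun t h1 h2 => ?_) ?_ k
    · have e1 : (S.filter fun x => -x i ≤ t) = S.filter fun x => -(t + δ) + δ ≤ x i :=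
        Finset.filter_congr fun x _ => by constructor <;> intro h <;> linarith
      have e2 : (S.filter fun x => t + δ ≤ -x i) = S.filter fun x => x i ≤ -(t + δ) :=
        Finset.filter_congr fun x _ => by constructor <;> intro h <;> linarith
      rw [e1] at h1
      rw [e2] at h2
      rw [e1, e2, add_comm]
      exact hns i _ h2 h1
    · simpa only [neg_lt_neg_iff] using hlow i
  set v : (Fin n → ℝ) → Fin n → ℤ := fun x i => round (2 * (x i - m i)) with hv
  have hvinj : Set.InjOn v S := by
    intro x hx y hy hxy
    by_contra hne
    obtain ⟨i, hi⟩ := hsep x hx y hy hne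
    have hi' : round (2 * (x i - m i)) = round (2 * (y i - m i)) := congrFun hxy i
    have h1 := abs_le.1 (abs_sub_round (2 * (x i - m i)))
    have h2 := abs_le.1 (abs_sub_round (2 * (y i - m i)))
    rw [hi'] at h1
    exact absurd (abs_le.2 ⟨by linarith, by linarith⟩) (not_le.2 hi)
  refine hcard.not_ge (log_card_le_of_tail S hS v hvinj hq0 hq2 fun i j hj => ?_)
  have hj' : (1 : ℝ) ≤ j := by exact_mod_cast hj
  have hKδ : ((K * j : ℕ) : ℝ) * δ = j / 8 := by
    rw [hδ]
    push_cast
    field_simp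
  have hsub : (S.filter fun x => j ≤ (v x i).natAbs) ⊆
      (S.filter fun x => m i + (K * j : ℕ) * δ < x i) ∪
        (S.filter fun x => -m i + (K * j : ℕ) * δ < -x i) := by
    intro x hx
    rw [hKδ]
    simp only [Finset.mem_union, Finset.mem_filter] at hx ⊢
    have h1 := abs_le.1 (abs_sub_round (2 * (x i - m i)))
    have h2 : (j : ℤ) ≤ v x i ∨ v x i ≤ -(j : ℤ) := by omega
    rcases h2 with h2 | h2
    · have h3 : (j : ℝ) ≤ (round (2 * (x i - m i)) : ℝ) := by exact_mod_cast h2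
      exact Or.inl ⟨hx.1, by linarith⟩
    · have h3 : (round (2 * (x i - m i)) : ℝ) ≤ -(j : ℝ) := by exact_mod_cast h2
      exact Or.inr ⟨hx.1, by linarith⟩
  have hpow : (1 / 2 : ℝ) ^ (M ^ (K * j)) ≤ q ^ j := by
    rw [hq, ← Real.rpow_natCast ((1 / 2 : ℝ) ^ R), ← Real.rpow_mul (by norm_num), pow_mul]
    exact Real.rpow_le_rpow_of_exponent_ge (by norm_num) (by norm_num)
      (mul_natCast_le_pow hR2 hj)
  have hle : ((S.filter fun x => j ≤ (v x i).natAbs).card : ℝ) ≤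
      (S.filter fun x => m i + (K * j : ℕ) * δ < x i).card +
        (S.filter fun x => -m i + (K * j : ℕ) * δ < -x i).card := by
    exact_mod_cast (Finset.card_le_card hsub).trans (Finset.card_union_le _ _)
  have hc0 : (0 : ℝ) ≤ S.card := Nat.cast_nonneg _
  have := mul_le_mul_of_nonneg_right hpow hc0
  linarith [htail i (K * j), htail' i (K * j)]

/-- If every subset of `S` with more than `h` points splits efficiently along a coordinate gap, then
the dilate of `S` has large cell content. -/
theorem rpow_card_div_le_cellContent {n : ℕ} (S : Finset (Fin n → ℝ)) {M h δ c : ℝ} (hM : 0 < M)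
    (hh : 0 < h) (hc : 0 < c) (hδ : 0 < δ) (hcδ : 2 ≤ c * δ)
    (hsplit : ∀ T ⊆ S, h < T.card → ∃ (i : Fin n) (t : ℝ),
      (T.filter fun x => x i ≤ t).Nonempty ∧
      (T.filter fun x => t + δ ≤ x i).Nonempty ∧
      (T.card : ℝ) ^ M⁻¹ ≤ ((T.filter fun x => x i ≤ t).card : ℝ) ^ M⁻¹ +
        ((T.filter fun x => t + δ ≤ x i).card : ℝ) ^ M⁻¹) :
    ENNReal.ofReal ((S.card / h) ^ M⁻¹) ≤ cellContent (c • (S : Set (Fin n → ℝ))) := by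
  classical
  induction S using Finset.strongInduction with
  | H S ih =>
    rcases S.eq_empty_or_nonempty with rfl | hS
    · simp [Real.zero_rpow (inv_pos.2 hM).ne']
    rcases le_or_gt (S.card : ℝ) h with hle | hlt
    · refine le_trans ?_ (one_le_cellContent (Set.Nonempty.smul_set (by exact_mod_cast hS)))
      rw [ENNReal.ofReal_le_one]
      exact Real.rpow_le_one (by positivity) ((div_le_one hh).2 hle) (inv_pos.2 hM).le
    obtain ⟨i, t, hlo, hhi, hcard⟩ := hsplit S subset_rfl hlt
    set T₁ := S.filter fun x => x i ≤ t with hT₁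
    set T₂ := S.filter fun x => t + δ ≤ x i with hT₂
    have hs₁ : T₁ ⊂ S := by
      refine Finset.filter_ssubset.2 ?_
      obtain ⟨x, hx⟩ := hhi
      rw [hT₂, Finset.mem_filter] at hx
      exact ⟨x, hx.1, by linarith [hx.2]⟩
    have hs₂ : T₂ ⊂ S := by
      refine Finset.filter_ssubset.2 ?_
      obtain ⟨x, hx⟩ := hlo
      rw [hT₁, Finset.mem_filter] at hx
      exact ⟨x, hx.1, by linarith [hx.2]⟩
    have i₁ := ih T₁ hs₁ fun T hT => hsplit T (hT.trans hs₁.subset)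
    have i₂ := ih T₂ hs₂ fun T hT => hsplit T (hT.trans hs₂.subset)
    have hadd : cellContent (c • (T₁ : Set (Fin n → ℝ))) +
        cellContent (c • (T₂ : Set (Fin n → ℝ))) ≤ cellContent (c • (S : Set (Fin n → ℝ))) := by
      refine cellContent_add_le (i := i) (a := ⌈c * t⌉)
        (Set.smul_set_mono (by exact_mod_cast hs₁.subset))
        (Set.smul_set_mono (by exact_mod_cast hs₂.subset)) ?_ ?_
      · rintro _ ⟨x, hx, rfl⟩
        have hx' : x i ≤ t := (Finset.mem_filter.1 (Finset.mem_coe.1 hx)).2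
        exact (mul_le_mul_of_nonneg_left hx' hc.le).trans (Int.le_ceil _)
      · rintro _ ⟨x, hx, rfl⟩
        have hx' : t + δ ≤ x i := (Finset.mem_filter.1 (Finset.mem_coe.1 hx)).2
        have h1 := mul_le_mul_of_nonneg_left hx' hc.le
        have h2 := Int.ceil_lt_add_one (c * t)
        simp only [Pi.smul_apply, smul_eq_mul]
        linarith
    refine le_trans ?_ ((add_le_add i₁ i₂).trans hadd)
    rw [← ENNReal.ofReal_add (by positivity) (by positivity)]
    refine ENNReal.ofReal_le_ofReal ?_
    rw [Real.div_rpow (by positivity) hh.le, Real.div_rpow (by positivity) hh.le,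
      Real.div_rpow (by positivity) hh.le, ← add_div]
    exact div_le_div_of_nonneg_right hcard (by positivity)

theorem four_mul_half_rpow_le {R : ℝ} (hR : 16 ≤ R) :
    4 * (1 / 2 : ℝ) ^ R * (1 - Real.log ((1 / 2 : ℝ) ^ R)) ≤ 1 / 2 * Real.exp (-(R / 16)) := by
  have hl := Real.log_two_gt_d9
  have hl' := Real.log_two_lt_d9
  have hlog : Real.log ((1 / 2 : ℝ) ^ R) = -(R * Real.log 2) := by
    rw [Real.log_rpow (by norm_num), one_div, Real.log_inv]
    ring
  have hpow : (1 / 2 : ℝ) ^ R = Real.exp (-(R * Real.log 2)) := by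
    rw [← hlog, Real.exp_log (Real.rpow_pos_of_pos (by norm_num) _)]
  have hle : Real.exp (-(R * Real.log 2)) ≤ Real.exp (-(R / 16)) * Real.exp (-(R / 16 * 10)) := by
    rw [← Real.exp_add]
    refine Real.exp_le_exp.2 ?_
    nlinarith
  have hten : 8 * (1 + R) ≤ Real.exp (R / 16 * 10) := by
    have h1 : Real.exp (R / 16 * 10) = Real.exp (R / 16) ^ 10 := by
      rw [← Real.exp_nat_mul]
      congr 1
      push_cast
      ring
    have h2 : R / 16 + 1 ≤ Real.exp (R / 16) := Real.add_one_le_exp _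
    have h3 : (2 : ℝ) ^ 9 ≤ Real.exp (R / 16) ^ 9 :=
      pow_le_pow_left₀ (by norm_num) (by linarith) 9
    rw [h1, pow_succ]
    nlinarith
  have hinv : Real.exp (-(R / 16 * 10)) * (8 * (1 + R)) ≤ 1 := by
    calc _ ≤ Real.exp (-(R / 16 * 10)) * Real.exp (R / 16 * 10) :=
          mul_le_mul_of_nonneg_left hten (Real.exp_pos _).le
      _ = 1 := by rw [← Real.exp_add]; simp
  rw [hlog, hpow]
  have hE := Real.exp_pos (-(R / 16))
  calc 4 * Real.exp (-(R * Real.log 2)) * (1 - -(R * Real.log 2))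
      ≤ 4 * (Real.exp (-(R / 16)) * Real.exp (-(R / 16 * 10))) * (1 + R) := by
        refine mul_le_mul (by linarith) ?_ ?_ (by positivity)
        · nlinarith
        · nlinarith
    _ = 1 / 2 * Real.exp (-(R / 16)) * (Real.exp (-(R / 16 * 10)) * (8 * (1 + R))) := by ring
    _ ≤ 1 / 2 * Real.exp (-(R / 16)) * 1 := mul_le_mul_of_nonneg_left hinv (by positivity)
    _ = _ := mul_one _

theorem one_le_log_exp_one_add {x : ℝ} (hx : 0 ≤ x) : 1 ≤ Real.log (Real.exp 1 + x) := by
  rw [Real.le_log_iff_exp_le (by positivity)]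
  linarith

theorem sixteen_mul_le_pow_ceil {L ε : ℝ} (hL : 1 ≤ L) (hε : 0 < ε) (hε1 : ε ≤ 1) :
    16 * L ≤ (2 * L ^ ε) ^ ⌈4 / ε⌉₊ := by
  have hL0 : 0 < L := by linarith
  have hK : 4 / ε ≤ (⌈4 / ε⌉₊ : ℝ) := Nat.le_ceil _
  have hεK : 1 ≤ ε * ⌈4 / ε⌉₊ := by
    have := (div_le_iff₀ hε).1 hK
    linarith
  have hK4 : 4 ≤ ⌈4 / ε⌉₊ := by
    have h1 : (4 : ℝ) ≤ 4 / ε := (le_div_iff₀ hε).2 (by linarith)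
    exact_mod_cast h1.trans hK
  rw [mul_pow, ← Real.rpow_natCast (L ^ ε), ← Real.rpow_mul hL0.le]
  refine mul_le_mul ?_ ?_ hL0.le (by positivity)
  · calc (16 : ℝ) = 2 ^ 4 := by norm_num
      _ ≤ 2 ^ ⌈4 / ε⌉₊ := pow_le_pow_right₀ (by norm_num) hK4
  · calc L = L ^ (1 : ℝ) := (Real.rpow_one _).symm
      _ ≤ _ := Real.rpow_le_rpow_of_exponent_le hL hεK

/-- A separated set of `k` points in `A` forces `k ≤ Σ(80 ε⁻¹ A)^M`. -/
theorem card_le_cellContent_rpow {n : ℕ} {A : Set (Fin n → ℝ)} {ε : ℝ} (hε : 0 < ε) (hε1 : ε ≤ 1)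
    {S : Finset (Fin n → ℝ)} (hSA : (S : Set (Fin n → ℝ)) ⊆ A) (h2 : 2 ≤ S.card)
    (hsep : ∀ x ∈ S, ∀ y ∈ S, x ≠ y → ∃ i, 1 / 2 < |x i - y i|) :
    (S.card : ℝ≥0∞) ≤ cellContent ((80 * ε⁻¹) • A) ^
      (4 * Real.log (Real.exp 1 + n / Real.log S.card) ^ ε) := by
  have hk2 : (2 : ℝ) ≤ S.card := by exact_mod_cast h2
  have hk0 : (0 : ℝ) < S.card := by linarith
  have hlk : 0 < Real.log S.card := Real.log_pos (by linarith)
  set x : ℝ := n / Real.log S.card with hx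
  have hx0 : 0 ≤ x := by positivity
  set L : ℝ := Real.log (Real.exp 1 + x) with hL
  have hL1 : 1 ≤ L := one_le_log_exp_one_add hx0
  set M : ℝ := 2 * L ^ ε with hM
  have hM2 : 2 ≤ M := by
    have := Real.one_le_rpow hL1 hε.le
    linarith
  set K : ℕ := ⌈4 / ε⌉₊ with hK
  have hR : 16 * L ≤ M ^ K := sixteen_mul_le_pow_ceil hL1 hε hε1
  have hK1 : 1 ≤ K := Nat.one_le_ceil_iff.2 (by positivity)
  have hK0 : (0 : ℝ) < K := by exact_mod_cast hK1
  have hKε : K * ε ≤ 5 := by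
    have h1 : (K : ℝ) < 4 / ε + 1 := Nat.ceil_lt_add_one (by positivity)
    have h3 : K * ε ≤ (4 / ε + 1) * ε := mul_le_mul_of_nonneg_right h1.le hε.le
    have h4 : (4 / ε + 1) * ε = 4 + ε := by field_simp
    linarith
  have hnum : n * (4 * (1 / 2 : ℝ) ^ (M ^ K) * (1 - Real.log ((1 / 2 : ℝ) ^ (M ^ K)))) ≤
      1 / 2 * Real.log S.card := by
    have h1 := four_mul_half_rpow_le (show 16 ≤ M ^ K by linarith)
    have h3 : Real.exp (-(M ^ K / 16)) ≤ (Real.exp 1 + x)⁻¹ := by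
      rw [← Real.exp_log (show 0 < Real.exp 1 + x by positivity), ← Real.exp_neg]
      exact Real.exp_le_exp.2 (by rw [← hL]; linarith)
    have h4 : n * (Real.exp 1 + x)⁻¹ ≤ Real.log S.card := by
      rw [← div_eq_mul_inv, div_le_iff₀ (by positivity)]
      have : (n : ℝ) = Real.log S.card * x := by rw [hx]; field_simp
      rw [mul_add, ← this]
      have := mul_pos hlk (Real.exp_pos 1)
      linarith
    have hn : (0 : ℝ) ≤ n := Nat.cast_nonneg n
    have h5 := mul_le_mul_of_nonneg_left h1 hn
    have h6 := mul_le_mul_of_nonneg_left h3 hn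
    linarith
  have hsq : (0 : ℝ) < √S.card := Real.sqrt_pos.2 hk0
  have hmain := rpow_card_div_le_cellContent S (M := M) (h := √S.card) (δ := 1 / (8 * K))
    (c := 80 * ε⁻¹) (by linarith) hsq (by positivity) (by positivity) (by
      rw [show 80 * ε⁻¹ * (1 / (8 * (K : ℝ))) = 10 / (K * ε) by field_simp; norm_num,
        le_div_iff₀ (by positivity)]
      linarith) (by
      intro T hT hlt
      have hT0 : (0 : ℝ) < T.card := hsq.trans hlt
      refine exists_split T (Finset.card_pos.1 (by exact_mod_cast hT0))
        (fun x hx y hy => hsep x (hT hx) y (hT hy)) hM2 hK1 (hnum.trans_lt ?_)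
      have := Real.log_lt_log hsq hlt
      rw [Real.log_sqrt hk0.le] at this
      linarith)
  have hle := hmain.trans (cellContent_mono (Set.smul_set_mono (a := 80 * ε⁻¹) hSA))
  have hpos : 0 < 2 * M := by linarith
  have hsqrt : ((S.card : ℝ) / √S.card) ^ M⁻¹ = (S.card : ℝ) ^ (2 * M)⁻¹ := by
    rw [Real.div_sqrt, Real.sqrt_eq_rpow, ← Real.rpow_mul hk0.le]
    congr 1
    field_simp
  rw [hsqrt, ← ENNReal.ofReal_rpow_of_pos hk0, ENNReal.ofReal_natCast] at hle
  have hfin := ENNReal.rpow_le_rpow hle hpos.le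
  rw [← ENNReal.rpow_mul, inv_mul_cancel₀ hpos.ne', ENNReal.rpow_one] at hfin
  rwa [show 4 * L ^ ε = 2 * M by rw [hM]; ring]

theorem cellContent_eq_top {n : ℕ} {A : Set (Fin n → ℝ)} {ε : ℝ} (hε : 0 < ε) (hε1 : ε ≤ 1)
    (hA : coveringNumber A (unitCube n) = ⊤) : cellContent ((80 * ε⁻¹) • A) = ⊤ := by
  have h2pos : 0 < Real.log 2 := Real.log_pos (by norm_num)
  set E : ℝ := 4 * Real.log (Real.exp 1 + n / Real.log 2) ^ ε with hE
  have hk : ∀ k : ℕ, 2 ≤ k → (k : ℝ≥0∞) ≤ cellContent ((80 * ε⁻¹) • A) ^ E := by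
    intro k hk
    obtain ⟨S, hSA, rfl, hsep⟩ := exists_finset_separated (A := A) k (by rw [hA]; exact le_top)
    have hk2 : (2 : ℝ) ≤ S.card := by exact_mod_cast hk
    have hS : S.Nonempty := Finset.card_pos.1 (by omega)
    refine (card_le_cellContent_rpow hε hε1 hSA hk hsep).trans
      (ENNReal.rpow_le_rpow_of_exponent_le
        (one_le_cellContent (Set.Nonempty.smul_set (Set.Nonempty.mono hSA hS))) ?_)
    have hlog : Real.log 2 ≤ Real.log S.card := Real.log_le_log (by norm_num) hk2
    have hfrac : (n : ℝ) / Real.log S.card ≤ n / Real.log 2 :=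
      div_le_div_of_nonneg_left (Nat.cast_nonneg n) h2pos hlog
    have hfrac0 : 0 ≤ (n : ℝ) / Real.log S.card := by positivity
    have h1 := one_le_log_exp_one_add hfrac0
    have h2 : Real.log (Real.exp 1 + n / Real.log S.card) ≤
        Real.log (Real.exp 1 + n / Real.log 2) :=
      Real.log_le_log (by positivity) (by linarith)
    have := Real.rpow_le_rpow (by linarith) h2 hε.le
    linarith
  have htop : cellContent ((80 * ε⁻¹) • A) ^ E = ⊤ := by
    refine ENNReal.eq_top_of_forall_nnreal_le fun r => ?_
    obtain ⟨k, hk'⟩ := exists_nat_ge r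
    have hrk : (r : ℝ≥0∞) ≤ (max k 2 : ℕ) := by
      exact_mod_cast hk'.trans (Nat.cast_le.2 (le_max_left k 2))
    exact hrk.trans (hk _ (le_max_right k 2))
  have hE0 : 0 ≤ E := by
    have := one_le_log_exp_one_add (x := n / Real.log 2) (by positivity)
    have := Real.rpow_nonneg (show 0 ≤ Real.log (Real.exp 1 + n / Real.log 2) by linarith) ε
    linarith
  by_contra hne
  exact ENNReal.rpow_ne_top_of_nonneg hE0 hne htop

/-- If `N(A,Q) ≥ 2` for the unit cube `Q = [0,1]^n` and `0 < ε ≤ 1`, then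
`N(A,Q) ≤ Σ(C·ε⁻¹·A)^M` with `M = 4·(log(e + n/log N(A,Q)))^ε`, where `C` is absolute. If `A` is
unbounded, then `N(A,Q) = ∞`, the fraction is `0`, `M = 4`, and the claim is `Σ(C·ε⁻¹·A) = ∞`. -/
theorem covering_by_cubes :
    ∃ C > (0 : ℝ), ∀ (n : ℕ) (A : Set (Fin n → ℝ)) (ε : ℝ), 0 < ε → ε ≤ 1 →
      2 ≤ coveringNumber A (unitCube n) →
      ((coveringNumber A (unitCube n) : ℕ∞) : ℝ≥0∞) ≤
        (cellContent ((C * ε⁻¹) • A)) ^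
          (4 * (Real.log (Real.exp 1 +
            (n : ℝ) / Real.log (((coveringNumber A (unitCube n) : ℕ∞) : ℝ≥0∞).toReal))) ^ ε) := by
  refine ⟨80, by norm_num, fun n A ε hε hε1 h2 => ?_⟩
  rcases eq_or_ne (coveringNumber A (unitCube n)) ⊤ with hA | hA
  · rw [hA, cellContent_eq_top hε hε1 hA]
    simp
  · obtain ⟨k, hk⟩ := ENat.ne_top_iff_exists.1 hA
    obtain ⟨S, hSA, hcard, hsep⟩ := exists_finset_separated k hk.le
    rw [← hk] at h2 ⊢
    have hk2 : 2 ≤ k := by exact_mod_cast h2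
    have := card_le_cellContent_rpow hε hε1 hSA (hcard ▸ hk2) hsep
    rw [hcard] at this
    simpa using this
end

section
/- Let $n\ge 1$ and let $x_1,\dots,x_n$ be vectors in a real Banach space satisfying $\left\|\sum_{i=1}^n a_i x_i\right\| \le \sqrt{n}\,\left(\sum_{i=1}^n |a_i|^2\right)^{1/2}$ for all real numbers $(a_i)$, and $\mathbb{E}\left\|\sum_{i=1}^n g_i x_i\right\| \ge \delta n$ for some $\delta>0$, where $g_1,\dots,g_n$ are independent standard Gaussian random variables. Then there exist numbers $s>0$ and $t$ with $c\delta\le t\le 1$ satisfying $st \ge c\,\delta/(\log(2/\delta))^{3/2}$, and a subset $\sigma$ of $\{1,\dots,n\}$ with $|\sigma|\ge s^2 n$, such that $\left\|\sum_{i\in\sigma} a_i x_i\right\| \ge c\,t\sum_{i\in\sigma}|a_i|$ for all real numbers $(a_i)$, where $c>0$ is an absolute constant. -/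
/-- The law of `n` independent standard Gaussian random variables. -/
noncomputable def gaussPi (n : ℕ) : MeasureTheory.Measure (Fin n → ℝ) :=
  MeasureTheory.Measure.pi fun _ => ProbabilityTheory.gaussianReal 0 1

/-- `p` assigns to some coordinates a threshold from `J`; the pattern is shattered by `A` if every
choice of sides (above `hi`, below `lo`) is realised by some element of `A`. -/
def ShattersPattern {α ι J : Type*} (e : α → ι → ℝ) (lo hi : J → ℝ) (A : Finset α)
    (p : ι → Option J) : Prop :=
  ∀ ε : ι → Bool, ∃ f ∈ A, ∀ i j, p i = some j →
    (ε i = true → hi j ≤ e f i) ∧ (ε i = false → e f i ≤ lo j)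

section Shattering

variable {α ι J : Type*} {e : α → ι → ℝ} {lo hi : J → ℝ}

theorem ShattersPattern.mono {A B : Finset α} (h : A ⊆ B) {p : ι → Option J}
    (hp : ShattersPattern e lo hi A p) : ShattersPattern e lo hi B p := fun ε =>
  let ⟨f, hf, H⟩ := hp ε
  ⟨f, h hf, H⟩

open Classical in
/-- The patterns shattered by `A`. -/
noncomputable def shatteredPatterns [Fintype ι] [Fintype J] (e : α → ι → ℝ) (lo hi : J → ℝ)
    (A : Finset α) : Finset (ι → Option J) :=
  Finset.univ.filter (ShattersPattern e lo hi A)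

theorem mem_shatteredPatterns [Fintype ι] [Fintype J] {A : Finset α} {p : ι → Option J} :
    p ∈ shatteredPatterns e lo hi A ↔ ShattersPattern e lo hi A p := by
  simp [shatteredPatterns]

open Classical in
theorem card_shatteredPatterns_split [Fintype ι] [Fintype J] (hlt : ∀ j, lo j < hi j)
    (A : Finset α) (i : ι) (j : J) :
    (shatteredPatterns e lo hi (A.filter fun f => e f i ≤ lo j)).card +
      (shatteredPatterns e lo hi (A.filter fun f => hi j ≤ e f i)).card ≤
      (shatteredPatterns e lo hi A).card := by
  set S := shatteredPatterns e lo hi (A.filter fun f => e f i ≤ lo j) with hS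
  set T := shatteredPatterns e lo hi (A.filter fun f => hi j ≤ e f i) with hT
  have hnone : ∀ p ∈ S ∩ T, p i = none := by
    intro p hp
    rw [Finset.mem_inter, hS, hT, mem_shatteredPatterns, mem_shatteredPatterns] at hp
    rcases hpi : p i with _ | k
    · rfl
    · exfalso
      obtain ⟨f, hf, hf'⟩ := hp.1 fun _ => true
      obtain ⟨g, hg, hg'⟩ := hp.2 fun _ => false
      have h1 := (hf' i k hpi).1 rfl
      have h2 := (hg' i k hpi).2 rfl
      have h3 := (Finset.mem_filter.1 hf).2
      have h4 := (Finset.mem_filter.1 hg).2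
      linarith [hlt j, hlt k]
  have hinj : Set.InjOn (fun p : ι → Option J => Function.update p i (some j)) (S ∩ T : Finset _) := by
    intro p hp q hq hpq
    funext k
    by_cases hk : k = i
    · subst hk
      rw [hnone p hp, hnone q hq]
    · have := congrFun hpq k
      simpa [Function.update_of_ne hk] using this
  have hdisj : Disjoint (S ∪ T) ((S ∩ T).image fun p => Function.update p i (some j)) := by
    rw [Finset.disjoint_left]
    intro q hq hq'
    obtain ⟨p, hp, rfl⟩ := Finset.mem_image.1 hq'
    rcases Finset.mem_union.1 hq with h | h
    · rw [hS, mem_shatteredPatterns] at h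
      obtain ⟨f, hf, hf'⟩ := h fun _ => true
      have h1 := (hf' i j (by simp)).1 rfl
      have h3 := (Finset.mem_filter.1 hf).2
      linarith [hlt j]
    · rw [hT, mem_shatteredPatterns] at h
      obtain ⟨f, hf, hf'⟩ := h fun _ => false
      have h1 := (hf' i j (by simp)).2 rfl
      have h3 := (Finset.mem_filter.1 hf).2
      linarith [hlt j]
  have hsub : (S ∪ T) ∪ ((S ∩ T).image fun p => Function.update p i (some j)) ⊆
      shatteredPatterns e lo hi A := by
    intro q hq
    rw [mem_shatteredPatterns]
    rcases Finset.mem_union.1 hq with h | h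
    · rcases Finset.mem_union.1 h with h | h
      · exact (mem_shatteredPatterns.1 h).mono (Finset.filter_subset _ _)
      · exact (mem_shatteredPatterns.1 h).mono (Finset.filter_subset _ _)
    · obtain ⟨p, hp, rfl⟩ := Finset.mem_image.1 h
      have hp' := Finset.mem_inter.1 hp
      have hpS := mem_shatteredPatterns.1 hp'.1
      have hpT := mem_shatteredPatterns.1 hp'.2
      intro ε
      cases hε : ε i with
      | true =>
        obtain ⟨f, hf, hf'⟩ := hpT ε
        refine ⟨f, (Finset.mem_filter.1 hf).1, fun k l hkl => ?_⟩
        by_cases hk : k = i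
        · subst hk
          simp only [Function.update_self, Option.some.injEq] at hkl
          subst hkl
          simpa [hε] using (Finset.mem_filter.1 hf).2
        · exact hf' k l (by simpa [Function.update_of_ne hk] using hkl)
      | false =>
        obtain ⟨f, hf, hf'⟩ := hpS ε
        refine ⟨f, (Finset.mem_filter.1 hf).1, fun k l hkl => ?_⟩
        by_cases hk : k = i
        · subst hk
          simp only [Function.update_self, Option.some.injEq] at hkl
          subst hkl
          simpa [hε] using (Finset.mem_filter.1 hf).2
        · exact hf' k l (by simpa [Function.update_of_ne hk] using hkl)
  have := Finset.card_le_card hsub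
  rw [Finset.card_union_of_disjoint hdisj, Finset.card_image_of_injOn hinj,
    Finset.card_union_add_card_inter] at this
  exact this

open Classical in
/-- If every subset of `A` with at least two elements can be split along some coordinate into two
well-balanced parts, then `A` shatters at least `√|A|` patterns. -/
theorem sqrt_card_le_card_shatteredPatterns [Fintype ι] [Fintype J] (hlt : ∀ j, lo j < hi j)
    (A : Finset α) (hA : A.Nonempty)
    (hsplit : ∀ B ⊆ A, 2 ≤ B.card → ∃ i j,
      (B.filter fun f => e f i ≤ lo j).Nonempty ∧ (B.filter fun f => hi j ≤ e f i).Nonempty ∧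
      √(B.card : ℝ) ≤ √((B.filter fun f => e f i ≤ lo j).card : ℝ) +
        √((B.filter fun f => hi j ≤ e f i).card : ℝ)) :
    √(A.card : ℝ) ≤ (shatteredPatterns e lo hi A).card := by
  induction A using Finset.strongInduction with
  | H A ih =>
    rcases Nat.lt_or_ge A.card 2 with h | h
    · have h1 : A.card = 1 := by have := hA.card_pos; omega
      rw [h1]
      have : (fun _ => none) ∈ shatteredPatterns e lo hi A := by
        rw [mem_shatteredPatterns]
        intro ε
        obtain ⟨f, hf⟩ := hA
        exact ⟨f, hf, by simp⟩
      have := Finset.card_pos.2 ⟨_, this⟩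
      simpa using this
    · obtain ⟨i, j, h1, h2, h3⟩ := hsplit A subset_rfl h
      have hs1 : A.filter (fun f => e f i ≤ lo j) ⊂ A := by
        obtain ⟨f, hf⟩ := h2
        rw [Finset.mem_filter] at hf
        refine Finset.filter_ssubset.2 ⟨f, hf.1, ?_⟩
        linarith [hlt j, hf.2]
      have hs2 : A.filter (fun f => hi j ≤ e f i) ⊂ A := by
        obtain ⟨f, hf⟩ := h1
        rw [Finset.mem_filter] at hf
        refine Finset.filter_ssubset.2 ⟨f, hf.1, ?_⟩
        linarith [hlt j, hf.2]
      have i1 := ih _ hs1 h1 fun B hB => hsplit B (hB.trans hs1.subset)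
      have i2 := ih _ hs2 h2 fun B hB => hsplit B (hB.trans hs2.subset)
      have h4 := Nat.cast_le (α := ℝ).2 (card_shatteredPatterns_split (e := e) hlt A i j)
      push_cast at h4
      linarith

end Shattering

section Splitting

variable {α : Type*}

/-- Geometric decay of the upper tails bounds the second moment above a level. -/
theorem sum_sq_upper_le (B : Finset α) (X : α → ℝ) {η : ℝ} (hη : 0 < η) (r : ℕ) :
    ∀ k : ℤ, (∀ f ∈ B, X f < η * (k + r)) →
      (∀ l : ℤ, k ≤ l → 2 * ((B.filter fun f => η * ((l : ℝ) + 1) ≤ X f).card : ℝ) ≤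
        (B.filter fun f => η * (l : ℝ) ≤ X f).card) →
      ∑ f ∈ B with η * (k : ℝ) ≤ X f, (X f - η * k) ^ 2 ≤
        10 * η ^ 2 * ((B.filter fun f => η * (k : ℝ) ≤ X f).card : ℝ) := by
  induction r with
  | zero =>
    intro k hk _
    have : (B.filter fun f => η * (k : ℝ) ≤ X f) = ∅ := by
      rw [Finset.filter_eq_empty_iff]
      intro f hf
      have := hk f hf
      simp at this
      linarith
    simp [this]
  | succ r ih =>
    intro k hk hdec
    have h1 := ih (k + 1) (fun f hf => by
      have := hk f hf; push_cast at this ⊢; linarith) (fun l hl => hdec l (by omega))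
    push_cast at h1
    have h2 := hdec k le_rfl
    set U := B.filter fun f => η * (k : ℝ) ≤ X f with hU
    have hUU : (B.filter fun f => η * ((k : ℝ) + 1) ≤ X f) =
        U.filter fun f => η * ((k : ℝ) + 1) ≤ X f := by
      ext f
      simp only [hU, Finset.mem_filter]
      constructor
      · rintro ⟨a, b⟩
        exact ⟨⟨a, by nlinarith⟩, b⟩
      · rintro ⟨⟨a, _⟩, b⟩
        exact ⟨a, b⟩
    rw [hUU] at h1 h2
    rw [← Finset.sum_filter_add_sum_filter_not U (fun f => η * ((k : ℝ) + 1) ≤ X f)]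
    have h3 : ∑ f ∈ U with η * ((k : ℝ) + 1) ≤ X f, (X f - η * k) ^ 2 ≤
        ∑ f ∈ U with η * ((k : ℝ) + 1) ≤ X f,
          (3 / 2 * (X f - η * (k + 1)) ^ 2 + 3 * η ^ 2) := by
      refine Finset.sum_le_sum fun f _ => ?_
      nlinarith [sq_nonneg (X f - η * (k + 1) - 2 * η)]
    rw [Finset.sum_add_distrib, ← Finset.mul_sum, Finset.sum_const, nsmul_eq_mul] at h3
    have h4 : ∑ f ∈ U with ¬ η * ((k : ℝ) + 1) ≤ X f, (X f - η * k) ^ 2 ≤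
        ∑ f ∈ U with ¬ η * ((k : ℝ) + 1) ≤ X f, η ^ 2 := by
      refine Finset.sum_le_sum fun f hf => ?_
      rw [Finset.mem_filter, hU, Finset.mem_filter] at hf
      obtain ⟨⟨_, h5⟩, h6⟩ := hf
      exact pow_le_pow_left₀ (by linarith) (by linarith) 2
    rw [Finset.sum_const, nsmul_eq_mul] at h4
    have h5 : ((U.filter fun f => ¬ η * ((k : ℝ) + 1) ≤ X f).card : ℝ) ≤ U.card :=
      Nat.cast_le.2 (Finset.card_filter_le _ _)
    have hη2 : 0 < η ^ 2 := by positivity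
    nlinarith [mul_le_mul_of_nonneg_left h5 hη2.le, mul_le_mul_of_nonneg_left h2 hη2.le]

theorem one_le_sqrt_add_sqrt_half {b : ℝ} (h0 : 0 ≤ b) (h1 : b ≤ 1 / 2) :
    1 ≤ √(1 - b) + √(b / 2) := by
  have h2 : 1 - b ≤ √(1 - b) := by
    apply Real.le_sqrt_of_sq_le
    nlinarith
  have h3 : b ≤ √(b / 2) := by
    apply Real.le_sqrt_of_sq_le
    nlinarith
  linarith

theorem sqrt_le_sqrt_add_sqrt {N m u w : ℝ} (hm0 : 0 ≤ m) (hm : 2 * m ≤ N)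
    (hu : N - m ≤ u) (hw : m ≤ 2 * w) : √N ≤ √u + √w := by
  rcases hm0.eq_or_lt with rfl | hm0'
  · have : √N ≤ √u := Real.sqrt_le_sqrt (by linarith)
    linarith [Real.sqrt_nonneg w]
  have hN : 0 < N := by linarith
  have h := one_le_sqrt_add_sqrt_half (b := m / N) (by positivity)
    (by rw [div_le_div_iff₀ hN two_pos]; linarith)
  have h1 : √N * √(1 - m / N) ≤ √u := by
    rw [← Real.sqrt_mul hN.le]
    apply Real.sqrt_le_sqrt
    have : N * (1 - m / N) = N - m := by field_simp
    linarith
  have h2 : √N * √(m / N / 2) ≤ √w := by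
    rw [← Real.sqrt_mul hN.le]
    apply Real.sqrt_le_sqrt
    have : N * (m / N / 2) = m / 2 := by field_simp
    linarith
  nlinarith [Real.sqrt_nonneg N]

/-- If no grid threshold splits the values of `X` well, the upper tails above a median decay
geometrically, so the second moment there is small. -/
theorem sum_sq_upper_le_of_not_split (B : Finset α) (X : α → ℝ) {η : ℝ} (hη : 0 < η)
    (hno : ∀ j : ℤ, (B.filter fun f => X f ≤ η * j).Nonempty →
      (B.filter fun f => η * ((j : ℝ) + 1) ≤ X f).Nonempty →
      √((B.filter fun f => X f ≤ η * j).card : ℝ) +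
        √((B.filter fun f => η * ((j : ℝ) + 1) ≤ X f).card : ℝ) < √(B.card : ℝ))
    (k : ℤ) (hk : 2 * ((B.filter fun f => η * (k : ℝ) ≤ X f).card : ℝ) ≤ B.card) :
    ∑ f ∈ B with η * (k : ℝ) ≤ X f, (X f - η * k) ^ 2 ≤ 5 * η ^ 2 * B.card := by
  obtain ⟨M, hM⟩ : ∃ M : ℝ, ∀ f ∈ B, X f ≤ M := by
    obtain ⟨M, hM⟩ := (B.finite_toSet.image X).bddAbove
    exact ⟨M, fun f hf => hM ⟨f, hf, rfl⟩⟩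
  obtain ⟨r, hr⟩ := exists_nat_gt ((M - η * k) / η)
  rw [div_lt_iff₀ hη] at hr
  refine (sum_sq_upper_le B X hη r k (fun f hf => ?_) fun l hl => ?_).trans ?_
  · have := hM f hf
    linarith
  · by_contra! hcon
    set m := ((B.filter fun f => η * (l : ℝ) ≤ X f).card : ℝ) with hm
    have hm0 : 0 ≤ m := Nat.cast_nonneg _
    have hmk : m ≤ ((B.filter fun f => η * (k : ℝ) ≤ X f).card : ℝ) := by
      refine Nat.cast_le.2 (Finset.card_le_card fun f hf => ?_)
      rw [Finset.mem_filter] at hf ⊢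
      have : (k : ℝ) ≤ l := Int.cast_le.2 hl
      exact ⟨hf.1, by nlinarith [hf.2]⟩
    have hu : (B.card : ℝ) - m ≤ ((B.filter fun f => X f ≤ η * l).card : ℝ) := by
      have h1 := Finset.card_filter_add_card_filter_not (s := B) (fun f => η * (l : ℝ) ≤ X f)
      have h2 : (B.filter fun f => ¬ η * (l : ℝ) ≤ X f).card ≤
          (B.filter fun f => X f ≤ η * l).card := by
        refine Finset.card_le_card fun f hf => ?_
        rw [Finset.mem_filter] at hf ⊢
        exact ⟨hf.1, by linarith [hf.2]⟩
      have h3 : ((_ + _ : ℕ) : ℝ) = _ := congrArg Nat.cast h1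
      have h4 : ((_ : ℕ) : ℝ) ≤ _ := Nat.cast_le.2 h2
      push_cast at h3
      linarith
    have hw : 0 < ((B.filter fun f => η * ((l : ℝ) + 1) ≤ X f).card : ℝ) := by linarith
    have hwB : ((B.filter fun f => η * ((l : ℝ) + 1) ≤ X f).card : ℝ) ≤ B.card :=
      Nat.cast_le.2 (Finset.card_filter_le _ _)
    have := hno l (Finset.card_pos.1 (by
      have : (0 : ℝ) < ((B.filter fun f => X f ≤ η * l).card : ℝ) := by linarith
      exact_mod_cast this)) (Finset.card_pos.1 (by exact_mod_cast hw))
    exact absurd (sqrt_le_sqrt_add_sqrt hm0 (by linarith) hu hcon.le) (not_le.2 this)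
  · have : 0 < η ^ 2 := by positivity
    nlinarith

/-- Small deviation principle: a spread-out function on a finite set has a grid threshold splitting
the set into two well-balanced parts. -/
theorem exists_split_s19 (B : Finset α) (hB : B.Nonempty) (X : α → ℝ) {η : ℝ} (hη : 0 < η)
    (hvar : 44 * η ^ 2 * (B.card : ℝ) ^ 2 < ∑ f ∈ B, ∑ g ∈ B, (X f - X g) ^ 2) :
    ∃ j : ℤ, (B.filter fun f => X f ≤ η * j).Nonempty ∧
      (B.filter fun f => η * ((j : ℝ) + 1) ≤ X f).Nonempty ∧
      √(B.card : ℝ) ≤ √((B.filter fun f => X f ≤ η * j).card : ℝ) +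
        √((B.filter fun f => η * ((j : ℝ) + 1) ≤ X f).card : ℝ) := by
  by_contra! hno
  have hBpos : (0 : ℝ) < B.card := by exact_mod_cast hB.card_pos
  obtain ⟨M, hM⟩ : ∃ M : ℝ, ∀ f ∈ B, |X f| ≤ M := by
    obtain ⟨M, hM⟩ := (B.finite_toSet.image fun f => |X f|).bddAbove
    exact ⟨M, fun f hf => hM ⟨f, hf, rfl⟩⟩
  -- a grid median
  obtain ⟨k, hk1, hk2⟩ : ∃ k : ℤ,
      (B.card : ℝ) ≤ 2 * ((B.filter fun f => η * (k : ℝ) ≤ X f).card : ℝ) ∧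
      ∀ z : ℤ, (B.card : ℝ) ≤ 2 * ((B.filter fun f => η * (z : ℝ) ≤ X f).card : ℝ) → z ≤ k := by
    refine Int.exists_greatest_of_bdd ⟨⌈M / η⌉, fun z hz => ?_⟩ ⟨-⌈M / η⌉, ?_⟩
    · have : (0 : ℝ) < ((B.filter fun f => η * (z : ℝ) ≤ X f).card : ℝ) := by linarith
      obtain ⟨f, hf⟩ := Finset.card_pos.1 (by exact_mod_cast this)
      rw [Finset.mem_filter] at hf
      have h1 := (abs_le.1 (hM f hf.1)).2
      have h2 : (z : ℝ) ≤ M / η := by rw [le_div_iff₀ hη]; linarith [hf.2]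
      exact_mod_cast h2.trans (Int.le_ceil _)
    · have : (B.filter fun f => η * ((-⌈M / η⌉ : ℤ) : ℝ) ≤ X f) = B := by
        rw [Finset.filter_eq_self]
        intro f hf
        have h1 := (abs_le.1 (hM f hf)).1
        have h2 := Int.le_ceil (M / η)
        rw [div_le_iff₀ hη] at h2
        push_cast
        linarith
      rw [this]
      linarith
  have hup := sum_sq_upper_le_of_not_split B X hη hno (k + 1) (by
    by_contra! h
    have := hk2 (k + 1) h.le
    omega)
  have hdown := sum_sq_upper_le_of_not_split B (fun f => -X f) hη (fun j h1 h2 => by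
    have e1 : (B.filter fun f => -X f ≤ η * j) =
        B.filter fun f => η * (((-j - 1 : ℤ) : ℝ) + 1) ≤ X f := by
      refine Finset.filter_congr fun f _ => ?_
      push_cast
      constructor <;> intro h <;> linarith
    have e2 : (B.filter fun f => η * ((j : ℝ) + 1) ≤ -X f) =
        B.filter fun f => X f ≤ η * ((-j - 1 : ℤ) : ℝ) := by
      refine Finset.filter_congr fun f _ => ?_
      push_cast
      constructor <;> intro h <;> linarith
    rw [e1] at h1 ⊢
    rw [e2] at h2 ⊢
    rw [add_comm]
    exact hno (-j - 1) h2 h1) (-k + 1) (by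
    have h1 := Finset.card_filter_add_card_filter_not (s := B) (fun f => η * (k : ℝ) ≤ X f)
    have h2 : (B.filter fun f => η * ((-k + 1 : ℤ) : ℝ) ≤ -X f).card ≤
        (B.filter fun f => ¬ η * (k : ℝ) ≤ X f).card := by
      refine Finset.card_le_card fun f hf => ?_
      rw [Finset.mem_filter] at hf ⊢
      have := hf.2
      push_cast at this
      exact ⟨hf.1, by linarith⟩
    have h3 : ((_ + _ : ℕ) : ℝ) = _ := congrArg Nat.cast h1
    have h4 : ((_ : ℕ) : ℝ) ≤ _ := Nat.cast_le.2 h2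
    push_cast at h3 h4 ⊢
    linarith)
  have hpt : ∀ f, (X f - η * k) ^ 2 ≤ 2 * η ^ 2 +
      (2 * (if η * ((k + 1 : ℤ) : ℝ) ≤ X f then (X f - η * ((k + 1 : ℤ) : ℝ)) ^ 2 else 0) +
      2 * (if η * ((-k + 1 : ℤ) : ℝ) ≤ -X f then (-X f - η * ((-k + 1 : ℤ) : ℝ)) ^ 2 else 0)) := by
    intro f
    push_cast
    split_ifs with h1 h2 h2
    · nlinarith
    · nlinarith [sq_nonneg (X f - η * (k + 1) - η)]
    · nlinarith [sq_nonneg (-X f - η * (-k + 1) - η)]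
    · have : (X f - η * k) ^ 2 ≤ η ^ 2 := by
        apply sq_le_sq'
        · linarith
        · linarith
      nlinarith [sq_nonneg η]
  have hcen : ∑ f ∈ B, (X f - η * k) ^ 2 ≤ 22 * η ^ 2 * B.card := by
    refine (Finset.sum_le_sum fun f _ => hpt f).trans ?_
    rw [Finset.sum_add_distrib, Finset.sum_add_distrib, Finset.sum_const, nsmul_eq_mul,
      ← Finset.mul_sum, ← Finset.mul_sum, ← Finset.sum_filter, ← Finset.sum_filter]
    linarith
  have hexp : ∑ f ∈ B, ∑ g ∈ B, (X f - X g) ^ 2 ≤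
      2 * B.card * ∑ f ∈ B, (X f - η * k) ^ 2 := by
    have : ∑ f ∈ B, ∑ g ∈ B, (X f - X g) ^ 2 = ∑ f ∈ B, ∑ g ∈ B,
        ((X f - η * k) ^ 2 + (X g - η * k) ^ 2 - 2 * ((X f - η * k) * (X g - η * k))) := by
      refine Finset.sum_congr rfl fun f _ => Finset.sum_congr rfl fun g _ => by ring
    rw [this]
    simp only [Finset.sum_sub_distrib, Finset.sum_add_distrib, ← Finset.mul_sum, Finset.sum_const,
      nsmul_eq_mul, ← Finset.sum_mul]
    nlinarith [sq_nonneg (∑ f ∈ B, (X f - η * k))]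
  nlinarith

end Splitting

section Entropy

variable {α ι J : Type*}

open Classical in
/-- Number of patterns with small support, bounded by a generating function. -/
theorem card_filter_pattern_le [Fintype ι] [Fintype J] {y V : ℝ} (hy : 0 < y) (hy1 : y ≤ 1)
    (S : Finset (ι → Option J))
    (hS : ∀ p ∈ S, ((Finset.univ.filter fun i => (p i).isSome).card : ℝ) ≤ V) :
    (S.card : ℝ) ≤ y ^ (-V) * (1 + Fintype.card J * y) ^ Fintype.card ι := by
  have h1 : ∀ p ∈ S, (1 : ℝ) ≤ y ^ (-V) * ∏ i, (if (p i).isSome then y else 1) := by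
    intro p hp
    rw [Finset.prod_ite, Finset.prod_const, Finset.prod_const_one, mul_one,
      ← Real.rpow_natCast, ← Real.rpow_add hy]
    exact Real.one_le_rpow_of_pos_of_le_one_of_nonpos hy hy1 (by linarith [hS p hp])
  calc (S.card : ℝ) = ∑ p ∈ S, (1 : ℝ) := by simp
    _ ≤ ∑ p ∈ S, y ^ (-V) * ∏ i, (if (p i).isSome then y else 1) := Finset.sum_le_sum h1
    _ ≤ ∑ p : ι → Option J, y ^ (-V) * ∏ i, (if (p i).isSome then y else 1) := by
        refine Finset.sum_le_sum_of_subset_of_nonneg (Finset.subset_univ _) fun p _ _ => ?_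
        refine mul_nonneg (Real.rpow_nonneg hy.le _) (Finset.prod_nonneg fun i _ => ?_)
        split_ifs <;> linarith
    _ = y ^ (-V) * (1 + Fintype.card J * y) ^ Fintype.card ι := by
        rw [← Finset.mul_sum,
          ← Fintype.prod_sum (fun (_ : ι) (o : Option J) => if o.isSome then y else (1 : ℝ))]
        simp [Fintype.sum_option]

open Classical in
/-- Entropy bound: a bounded, `t`-separated set in normalised `L₂` that shatters (with gap `t/10`)
no coordinate set of size `≥ V` has logarithmic cardinality at most `2V(1 + log(Rn/V))`. -/
theorem log_card_le_of_not_shattered [Fintype ι] [Nonempty ι] (e : α → ι → ℝ) (A : Finset α)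
    {M t V R : ℝ} (ht : 0 < t) (hV : 0 < V) (hM : 0 ≤ M) (hR : 20 * M / t + 1 ≤ R)
    (hVR : V ≤ R * Fintype.card ι)
    (hbd : ∀ f ∈ A, ∀ i, |e f i| ≤ M)
    (hsep : ∀ f ∈ A, ∀ g ∈ A, f ≠ g → t ^ 2 * Fintype.card ι ≤ ∑ i, (e f i - e g i) ^ 2)
    (hsh : ∀ σ : Finset ι, V ≤ σ.card → ¬ ∃ h : ι → ℝ, ∀ ε : ι → Bool, ∃ f ∈ A, ∀ i ∈ σ,
      (ε i = true → h i + t / 10 ≤ e f i) ∧ (ε i = false → e f i ≤ h i)) :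
    Real.log A.card ≤ 2 * V * (1 + Real.log (R * Fintype.card ι / V)) := by
  have hn : (0 : ℝ) < Fintype.card ι := by exact_mod_cast Fintype.card_pos
  have hMt : 0 ≤ M / t := by positivity
  have hR1 : 1 ≤ R := by
    have : 0 ≤ 20 * M / t := by positivity
    linarith
  have hlog : 0 ≤ Real.log (R * Fintype.card ι / V) :=
    Real.log_nonneg (by rw [le_div_iff₀ hV]; linarith)
  rcases A.eq_empty_or_nonempty with rfl | hA
  · simp only [Finset.card_empty, Nat.cast_zero, Real.log_zero]
    positivity
  set η := t / 10 with hη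
  have hη0 : 0 < η := by positivity
  set z : ℤ := ⌊M / η⌋ with hz
  have hz0 : 0 ≤ z := Int.floor_nonneg.2 (by positivity)
  let J := {j : ℤ // j ∈ Finset.Icc (-z) z}
  have hJ : (Fintype.card J : ℝ) ≤ R := by
    have h1 : Fintype.card J = (2 * z + 1).toNat := by
      rw [Fintype.card_coe, Int.card_Icc]
      congr 1
      ring
    have h2 : ((2 * z + 1).toNat : ℝ) = 2 * z + 1 := by
      have : (((2 * z + 1).toNat : ℤ) : ℝ) = ((2 * z + 1 : ℤ) : ℝ) := by
        rw [Int.toNat_of_nonneg (by omega)]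
      push_cast at this
      exact this
    have h3 : (z : ℝ) ≤ M / η := Int.floor_le _
    have h4 : M / η = 10 * M / t := by
      rw [hη]
      field_simp
    rw [h1, h2]
    have h5 : 20 * M / t = 2 * (10 * M / t) := by ring
    linarith
  let lo : J → ℝ := fun j => η * (j : ℤ)
  let hi : J → ℝ := fun j => η * (((j : ℤ) : ℝ) + 1)
  have hlohi : ∀ j, hi j = lo j + η := fun j => by simp only [lo, hi]; ring
  have hmain := sqrt_card_le_card_shatteredPatterns (e := e) (lo := lo) (hi := hi)
    (fun j => by rw [hlohi]; linarith) A hA (by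
      intro B hBA hB
      have hBne : B.Nonempty := Finset.card_pos.1 (by omega)
      have hB2 : (2 : ℝ) ≤ B.card := by exact_mod_cast hB
      have htot : t ^ 2 * Fintype.card ι * (B.card * (B.card - 1)) ≤
          ∑ i, ∑ f ∈ B, ∑ g ∈ B, (e f i - e g i) ^ 2 := by
        have h0 : ∑ i, ∑ f ∈ B, ∑ g ∈ B, (e f i - e g i) ^ 2 =
            ∑ f ∈ B, ∑ g ∈ B, ∑ i, (e f i - e g i) ^ 2 := by
          rw [Finset.sum_comm]
          exact Finset.sum_congr rfl fun f _ => Finset.sum_comm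
        rw [h0]
        have h1 : ∀ f ∈ B, t ^ 2 * Fintype.card ι * (B.card - 1) ≤
            ∑ g ∈ B, ∑ i, (e f i - e g i) ^ 2 := by
          intro f hf
          rw [← Finset.add_sum_erase B _ hf]
          have h2 : ∑ g ∈ B.erase f, t ^ 2 * (Fintype.card ι : ℝ) ≤
              ∑ g ∈ B.erase f, ∑ i, (e f i - e g i) ^ 2 :=
            Finset.sum_le_sum fun g hg => hsep f (hBA hf) g (hBA (Finset.mem_of_mem_erase hg))
              (Finset.ne_of_mem_erase hg).symm
          rw [Finset.sum_const, nsmul_eq_mul, Finset.card_erase_of_mem hf,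
            Nat.cast_sub (by omega)] at h2
          push_cast at h2
          simp only [sub_self, ne_eq, OfNat.ofNat_ne_zero, not_false_eq_true, zero_pow,
            Finset.sum_const_zero, zero_add]
          linarith
        have := Finset.sum_le_sum h1
        rw [Finset.sum_const, nsmul_eq_mul] at this
        linarith
      obtain ⟨i, hi'⟩ : ∃ i, 44 * η ^ 2 * (B.card : ℝ) ^ 2 <
          ∑ f ∈ B, ∑ g ∈ B, (e f i - e g i) ^ 2 := by
        by_contra! hcon
        have h1 := Finset.sum_le_sum fun i (_ : i ∈ Finset.univ) => hcon i
        rw [Finset.sum_const, nsmul_eq_mul, Finset.card_univ] at h1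
        have h2 := htot.trans h1
        rw [hη] at h2
        have h3 : 0 < t ^ 2 * Fintype.card ι * B.card := by positivity
        have h4 : t ^ 2 * Fintype.card ι * B.card * (B.card - 1) ≤
            t ^ 2 * Fintype.card ι * B.card * (44 / 100 * B.card) := by
          calc _ = _ := by ring
            _ ≤ _ := h2
            _ = _ := by ring
        have := le_of_mul_le_mul_left h4 h3
        linarith
      obtain ⟨j, h1, h2, h3⟩ := exists_split_s19 B hBne (fun f => e f i) hη0 hi'
      have hj : j ∈ Finset.Icc (-z) z := by
        obtain ⟨f, hf⟩ := h1
        obtain ⟨g, hg⟩ := h2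
        rw [Finset.mem_filter] at hf hg
        have hf' := (abs_le.1 (hbd f (hBA hf.1) i)).1
        have hg' := (abs_le.1 (hbd g (hBA hg.1) i)).2
        rw [Finset.mem_Icc]
        constructor
        · rw [neg_le, hz, Int.le_floor, le_div_iff₀ hη0]
          push_cast
          linarith [hf.2]
        · rw [hz, Int.le_floor, le_div_iff₀ hη0]
          linarith [hg.2]
      exact ⟨i, ⟨j, hj⟩, h1, h2, h3⟩)
  have hsupp : ∀ p ∈ shatteredPatterns e lo hi A,
      ((Finset.univ.filter fun i => (p i).isSome).card : ℝ) ≤ V := by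
    intro p hp
    by_contra! hcon
    refine hsh _ hcon.le ⟨fun i => ((p i).map lo).getD 0, fun ε => ?_⟩
    obtain ⟨f, hf, hf'⟩ := mem_shatteredPatterns.1 hp ε
    refine ⟨f, hf, fun i hi' => ?_⟩
    rw [Finset.mem_filter, Option.isSome_iff_exists] at hi'
    obtain ⟨_, j, hj⟩ := hi'
    have := hf' i j hj
    rw [hlohi] at this
    simpa [hj] using this
  set y := V / (R * Fintype.card ι) with hy
  have hy0 : 0 < y := by positivity
  have hy1 : y ≤ 1 := by
    rw [hy, div_le_one (by positivity)]
    exact hVR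
  have hcount := card_filter_pattern_le hy0 hy1 _ hsupp
  have hexp : (1 + Fintype.card J * y) ^ Fintype.card ι ≤ Real.exp V := by
    have h1 : (Fintype.card J : ℝ) * y ≤ V / Fintype.card ι := by
      calc (Fintype.card J : ℝ) * y ≤ R * y := by gcongr
        _ = V / Fintype.card ι := by rw [hy]; field_simp
    calc (1 + Fintype.card J * y) ^ Fintype.card ι
        ≤ (Real.exp (V / Fintype.card ι)) ^ Fintype.card ι := by
          gcongr
          linarith [Real.add_one_le_exp (V / Fintype.card ι)]
      _ = Real.exp V := by
          rw [← Real.exp_nat_mul]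
          congr 1
          field_simp
  have hfin : √(A.card : ℝ) ≤ y ^ (-V) * Real.exp V :=
    hmain.trans (hcount.trans (by gcongr))
  have hApos : (0 : ℝ) < A.card := by exact_mod_cast hA.card_pos
  have h5 := Real.log_le_log (Real.sqrt_pos.2 hApos) hfin
  rw [Real.log_sqrt hApos.le, Real.log_mul (by positivity) (by positivity), Real.log_exp,
    Real.log_rpow hy0] at h5
  have h6 : Real.log (R * Fintype.card ι / V) = - Real.log y := by
    rw [hy, ← Real.log_inv, inv_div]
  rw [h6]
  linarith

end Entropy

open MeasureTheory ProbabilityTheory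

instance (n : ℕ) : IsProbabilityMeasure (gaussPi n) := by
  unfold gaussPi
  infer_instance

section Gaussian

variable {n : ℕ}

theorem exp_sum_eq_prod (u : Fin n → ℝ) (g : Fin n → ℝ) :
    Real.exp (∑ i, g i * u i) = ∏ i, Real.exp (u i * g i) := by
  rw [Real.exp_sum]
  simp only [mul_comm]

theorem integrable_exp_sum_gaussPi (u : Fin n → ℝ) :
    Integrable (fun g => Real.exp (∑ i, g i * u i)) (gaussPi n) := by
  simp only [exp_sum_eq_prod]
  exact Integrable.fintype_prod (f := fun i x => Real.exp (u i * x))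
    fun i => integrable_exp_mul_gaussianReal (u i)

theorem integral_exp_sum_gaussPi (u : Fin n → ℝ) :
    ∫ g, Real.exp (∑ i, g i * u i) ∂(gaussPi n) = Real.exp ((∑ i, u i ^ 2) / 2) := by
  simp only [exp_sum_eq_prod]
  rw [gaussPi, integral_fintype_prod_eq_prod (fun i x => Real.exp (u i * x)), Finset.sum_div,
    Real.exp_sum]
  refine Finset.prod_congr rfl fun i _ => ?_
  have := congrFun (mgf_fun_id_gaussianReal (μ := 0) (v := 1)) (u i)
  simpa [mgf] using this

theorem integrable_pow_gaussPi (k : ℕ) (i : Fin n) :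
    Integrable (fun g : Fin n → ℝ => g i ^ k) (gaussPi n) := by
  refine integrable_comp_eval (μ := fun _ : Fin n => gaussianReal 0 1) (i := i)
    (f := fun x : ℝ => x ^ k) ?_
  have h := memLp_id_gaussianReal (μ := 0) (v := 1) k
  have := h.integrable_norm_pow'
  refine (integrable_norm_iff (by fun_prop)).1 ?_
  simpa using this

theorem integral_sq_gaussPi (i : Fin n) : ∫ g : Fin n → ℝ, g i ^ 2 ∂(gaussPi n) = 1 := by
  rw [gaussPi, integral_comp_eval (μ := fun _ : Fin n => gaussianReal 0 1) (i := i)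
    (f := fun x : ℝ => x ^ 2) (by fun_prop)]
  have h := variance_fun_id_gaussianReal (μ := 0) (v := 1)
  rw [variance_eq_integral (by fun_prop)] at h
  simpa using h

theorem integral_pow_four_gaussPi_le (i : Fin n) :
    ∫ g : Fin n → ℝ, g i ^ 4 ∂(gaussPi n) ≤ 80 := by
  have hpt : ∀ x : ℝ, x ^ 4 ≤ 24 * (Real.exp (1 * x) + Real.exp (-1 * x)) := by
    intro x
    have h1 : |x| ^ 4 / 24 ≤ Real.exp |x| := by
      have := Real.pow_div_factorial_le_exp |x| (abs_nonneg x) 4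
      simpa [Nat.factorial] using this
    have h2 : Real.exp |x| ≤ Real.exp (1 * x) + Real.exp (-1 * x) := by
      rcases abs_cases x with ⟨h, _⟩ | ⟨h, _⟩ <;> rw [h]
      · simpa using (Real.exp_pos _).le
      · simpa using (Real.exp_pos _).le
    have h3 : |x| ^ 4 = x ^ 4 := by simp [Even.pow_abs (show Even 4 by decide)]
    linarith
  rw [gaussPi, integral_comp_eval (μ := fun _ : Fin n => gaussianReal 0 1) (i := i)
    (f := fun x : ℝ => x ^ 4) (by fun_prop)]
  have i1 := integrable_exp_mul_gaussianReal (μ := 0) (v := 1) 1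
  have i2 := integrable_exp_mul_gaussianReal (μ := 0) (v := 1) (-1)
  have m1 := congrFun (mgf_fun_id_gaussianReal (μ := 0) (v := 1)) 1
  have m2 := congrFun (mgf_fun_id_gaussianReal (μ := 0) (v := 1)) (-1)
  simp only [mgf] at m1 m2
  have h := integral_mono_of_nonneg (μ := gaussianReal 0 1)
    (Filter.Eventually.of_forall fun x : ℝ => by positivity) ((i1.add i2).const_mul 24)
    (Filter.Eventually.of_forall hpt)
  simp only [Pi.add_apply] at h
  rw [integral_const_mul, integral_add i1 i2, m1, m2] at h
  refine h.trans ?_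
  have he : Real.exp (1 / 2) ≤ 5 / 3 := by
    have h1 : Real.exp (1 / 2) ^ 2 = Real.exp 1 := by
      rw [← Real.exp_nat_mul]; norm_num
    have h2 := Real.exp_one_lt_d9
    have h3 := Real.exp_pos (1 / 2)
    nlinarith
  norm_num at he ⊢
  linarith

/-- An integrable majorant of finitely many Gaussian linear forms with small expectation. -/
theorem exists_gaussian_majorant (F : Finset (Fin n → ℝ)) {r L : ℝ} (hr : 0 < r) (hL : 0 < L)
    (hF : Real.log F.card ≤ L) (hu : ∀ u ∈ F, ∑ i, u i ^ 2 ≤ r ^ 2) :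
    ∃ Φ : (Fin n → ℝ) → ℝ, Integrable Φ (gaussPi n) ∧
      (∀ u ∈ F, ∀ g, ∑ i, g i * u i ≤ Φ g) ∧ ∫ g, Φ g ∂(gaussPi n) ≤ r * √(2 * L) := by
  set q := √(2 * L) with hq
  have hq0 : 0 < q := Real.sqrt_pos.2 (by positivity)
  have hq2 : q ^ 2 = 2 * L := Real.sq_sqrt (by positivity)
  set l := q / r with hl
  have hl0 : 0 < l := by positivity
  set b := L + l ^ 2 * r ^ 2 / 2 with hb
  have hlr : l ^ 2 * r ^ 2 = 2 * L := by rw [hl, div_pow, hq2]; field_simp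
  have hbL : b = 2 * L := by rw [hb, hlr]; ring
  have hint : ∀ u : Fin n → ℝ, Integrable (fun g => Real.exp (∑ i, g i * (l * u i))) (gaussPi n) :=
    fun u => integrable_exp_sum_gaussPi _
  refine ⟨fun g => (b - 1 + Real.exp (-b) * ∑ u ∈ F, Real.exp (∑ i, g i * (l * u i))) / l,
    ?_, fun u hu' g => ?_, ?_⟩
  · exact ((integrable_const _).add
      ((integrable_finsetSum F fun u _ => hint u).const_mul _)).div_const _
  · rw [le_div_iff₀ hl0]
    have h1 : Real.exp (∑ i, g i * (l * u i)) ≤ ∑ u ∈ F, Real.exp (∑ i, g i * (l * u i)) :=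
      Finset.single_le_sum (f := fun u : Fin n → ℝ => Real.exp (∑ i, g i * (l * u i)))
        (fun _ _ => (Real.exp_pos _).le) hu'
    have h2 := Real.add_one_le_exp (-b + ∑ i, g i * (l * u i))
    rw [Real.exp_add] at h2
    have h3 := mul_le_mul_of_nonneg_left h1 (Real.exp_pos (-b)).le
    have h4 : ∑ i, g i * (l * u i) = (∑ i, g i * u i) * l := by
      rw [Finset.sum_mul]
      exact Finset.sum_congr rfl fun i _ => by ring
    linarith
  · rw [integral_div, integral_add (integrable_const _)
      ((integrable_finsetSum F fun u _ => hint u).const_mul _), integral_const_mul,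
      integral_finsetSum F fun u _ => hint u]
    simp only [integral_exp_sum_gaussPi, integral_const, probReal_univ, one_smul]
    rw [div_le_iff₀ hl0]
    have h1 : ∑ u ∈ F, Real.exp ((∑ i, (l * u i) ^ 2) / 2) ≤ Real.exp b := by
      have h2 : ∀ u ∈ F, Real.exp ((∑ i, (l * u i) ^ 2) / 2) ≤ Real.exp L := by
        intro u hu'
        apply Real.exp_le_exp.2
        simp only [mul_pow, ← Finset.mul_sum]
        have := mul_le_mul_of_nonneg_left (hu u hu') (sq_nonneg l)
        linarith
      refine (Finset.sum_le_sum h2).trans ?_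
      rw [Finset.sum_const, nsmul_eq_mul]
      have h3 : (F.card : ℝ) ≤ Real.exp L := by
        rcases F.eq_empty_or_nonempty with rfl | hne
        · simpa using (Real.exp_pos L).le
        · rw [← Real.log_le_iff_le_exp (by exact_mod_cast hne.card_pos)]
          exact hF
      calc (F.card : ℝ) * Real.exp L ≤ Real.exp L * Real.exp L := by gcongr
        _ = Real.exp b := by rw [← Real.exp_add, hbL, two_mul]
    have h4 := mul_le_mul_of_nonneg_left h1 (Real.exp_pos (-b)).le
    rw [← Real.exp_add, neg_add_cancel, Real.exp_zero] at h4
    have h5 : r * q * l = 2 * L := by rw [hl, ← hq2]; field_simp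
    linarith

end Gaussian

section Chaining

variable {n : ℕ}

/-- Bounded cardinality of separated subsets gives a finite net. -/
theorem exists_net (T : Set (Fin n → ℝ)) {τ L : ℝ} (hτ : 0 ≤ τ)
    (hT : ∀ A : Finset (Fin n → ℝ), ↑A ⊆ T →
      (∀ f ∈ A, ∀ g ∈ A, f ≠ g → τ ≤ ∑ i, (f i - g i) ^ 2) → Real.log A.card ≤ L) :
    ∃ A : Finset (Fin n → ℝ), ↑A ⊆ T ∧ Real.log A.card ≤ L ∧
      ∀ f ∈ T, ∃ u ∈ A, ∑ i, (f i - u i) ^ 2 ≤ τ := by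
  classical
  let P : ℕ → Prop := fun k => ∃ A : Finset (Fin n → ℝ), ↑A ⊆ T ∧
      (∀ f ∈ A, ∀ g ∈ A, f ≠ g → τ ≤ ∑ i, (f i - g i) ^ 2) ∧ A.card = k
  obtain ⟨b, hb⟩ := exists_nat_ge (Real.exp L)
  have hPb : ∀ k, P k → k ≤ b := by
    rintro k ⟨A, hA, hs, rfl⟩
    rcases A.eq_empty_or_nonempty with rfl | hne
    · simp
    · have := (Real.log_le_iff_le_exp (by exact_mod_cast hne.card_pos)).1 (hT A hA hs)
      exact_mod_cast this.trans hb
  have hP0 : P 0 := ⟨∅, by simp, by simp, by simp⟩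
  obtain ⟨A, hA, hs, hc⟩ := Nat.findGreatest_spec (P := P) (Nat.zero_le b) hP0
  refine ⟨A, hA, hT A hA hs, fun f hf => ?_⟩
  by_contra! hcon
  have hfA : f ∉ A := fun h => by
    have := hcon f h
    simp at this
    linarith
  have : P (A.card + 1) := by
    refine ⟨insert f A, ?_, ?_, Finset.card_insert_of_notMem hfA⟩
    · rw [Finset.coe_insert]
      exact Set.insert_subset hf hA
    · intro u hu v hv huv
      rw [Finset.mem_insert] at hu hv
      rcases hu with rfl | hu <;> rcases hv with rfl | hv
      · exact absurd rfl huv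
      · exact (hcon v hv).le
      · have := (hcon u hu).le
        simpa only [sub_sq_comm] using this
      · exact hs u hu v hv huv
  have h2 := Nat.le_findGreatest (hPb _ this) this
  omega

/-- Chaining: an integrable majorant for the Gaussian process on a net at scale `2⁻ᵐ`. -/
theorem exists_chaining_majorant (hn : 0 < n) (T : Set (Fin n → ℝ)) (h0 : 0 ∈ T)
    (hball : ∀ f ∈ T, ∑ i, f i ^ 2 ≤ n) {Q : ℝ} (hQ : 0 < Q) (m : ℕ)
    (hT : ∀ k ≤ m, ∀ A : Finset (Fin n → ℝ), ↑A ⊆ T →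
      (∀ f ∈ A, ∀ g ∈ A, f ≠ g → ((1 / 2 : ℝ) ^ k) ^ 2 * n ≤ ∑ i, (f i - g i) ^ 2) →
      Real.log A.card ≤ 4 ^ k * Q) :
    ∃ (A : Finset (Fin n → ℝ)) (Φ : (Fin n → ℝ) → ℝ), A.Nonempty ∧ Real.log A.card ≤ 4 ^ m * Q ∧
      (∀ f ∈ T, ∃ u ∈ A, ∑ i, (f i - u i) ^ 2 ≤ ((1 / 2 : ℝ) ^ m) ^ 2 * n) ∧
      Integrable Φ (gaussPi n) ∧ (∀ u ∈ A, ∀ g, ∑ i, g i * u i ≤ Φ g) ∧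
      ∫ g, Φ g ∂(gaussPi n) ≤ 4 * m * √(n * Q) := by
  classical
  have hn' : (0 : ℝ) < n := by exact_mod_cast hn
  induction m with
  | zero =>
    refine ⟨{0}, fun _ => 0, by simp, by simpa using hQ.le, fun f hf => ⟨0, by simp, ?_⟩,
      integrable_zero _ _ _, by simp, by simp⟩
    simpa using hball f hf
  | succ m ih =>
    obtain ⟨A, Φ, hAne, hAc, hA, hΦ, hΦA, hΦi⟩ := ih fun k hk => hT k (by omega)
    obtain ⟨A', hA'T, hA'c, hA'⟩ := exists_net T (τ := ((1 / 2 : ℝ) ^ (m + 1)) ^ 2 * n)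
      (by positivity) (hT (m + 1) le_rfl)
    have hA'ne : A'.Nonempty := by
      obtain ⟨u, hu, _⟩ := hA' 0 h0
      exact ⟨u, hu⟩
    set r := (1 / 2 : ℝ) ^ m * √n with hr
    have hr0 : 0 < r := by positivity
    let F := ((A' ×ˢ A).image fun p => p.1 - p.2).filter fun u => ∑ i, u i ^ 2 ≤ r ^ 2
    have hpos : (0 : ℝ) < A.card := by exact_mod_cast hAne.card_pos
    have hpos' : (0 : ℝ) < A'.card := by exact_mod_cast hA'ne.card_pos
    obtain ⟨Ψ, hΨ, hΨF, hΨi⟩ := exists_gaussian_majorant F (r := r) (L := 2 * (4 ^ (m + 1) * Q)) hr0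
      (by positivity) (by
        have h1 : F.card ≤ A'.card * A.card :=
          (Finset.card_filter_le _ _).trans (Finset.card_image_le.trans
            (Finset.card_product _ _).le)
        rcases F.eq_empty_or_nonempty with h | h
        · rw [h]
          simp only [Finset.card_empty, Nat.cast_zero, Real.log_zero]
          positivity
        · have h2 : (F.card : ℝ) ≤ A'.card * A.card := by exact_mod_cast h1
          have h3 := Real.log_le_log (by exact_mod_cast h.card_pos) h2
          rw [Real.log_mul hpos'.ne' hpos.ne'] at h3
          have h4 : (4 : ℝ) ^ (m + 1) * Q = 4 * (4 ^ m * Q) := by ring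
          have h5 : 0 < 4 ^ m * Q := by positivity
          linarith)
      fun u hu => (Finset.mem_filter.1 hu).2
    refine ⟨A', fun g => Φ g + Ψ g, hA'ne, hA'c, hA', hΦ.add hΨ, fun u hu g => ?_, ?_⟩
    · obtain ⟨v, hv, huv⟩ := hA u (hA'T hu)
      have hmem : u - v ∈ F := by
        refine Finset.mem_filter.2 ⟨Finset.mem_image.2 ⟨(u, v), by simp [hu, hv], rfl⟩, ?_⟩
        simp only [Pi.sub_apply]
        rwa [hr, mul_pow, Real.sq_sqrt hn'.le]
      have h1 := hΨF _ hmem g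
      have h2 := hΦA v hv g
      simp only [Pi.sub_apply, mul_sub, Finset.sum_sub_distrib] at h1
      linarith
    · rw [integral_add hΦ hΨ]
      have h1 : r * √(2 * (2 * (4 ^ (m + 1) * Q))) = 4 * √(n * Q) := by
        have h2 : 2 * (2 * ((4 : ℝ) ^ (m + 1) * Q)) = (2 * 2 ^ (m + 1)) ^ 2 * Q := by
          rw [mul_pow, ← pow_mul, mul_comm (m + 1) 2, pow_mul]
          norm_num
          ring
        rw [h2, Real.sqrt_mul (by positivity), Real.sqrt_sq (by positivity), hr,
          Real.sqrt_mul hn'.le]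
        have h3 : (1 / 2 : ℝ) ^ m * 2 ^ m = 1 := by
          rw [← mul_pow]; norm_num
        rw [pow_succ]
        linear_combination 4 * √(n : ℝ) * √Q * h3
      push_cast
      linarith

end Chaining
section Truncation

/-- Truncation of a real number at height `M`. -/
noncomputable def clip (M y : ℝ) : ℝ := max (-M) (min M y)

theorem abs_clip_le {M : ℝ} (hM : 0 ≤ M) (y : ℝ) : |clip M y| ≤ M :=
  abs_le.2 ⟨le_max_left _ _, max_le (by linarith) (min_le_left _ _)⟩

theorem abs_clip_le_abs {M : ℝ} (hM : 0 ≤ M) (y : ℝ) : |clip M y| ≤ |y| := by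
  unfold clip
  rcases max_cases (-M) (min M y) with h | h <;> rcases min_cases M y with h' | h' <;>
    rcases abs_cases y with h'' | h'' <;> rw [abs_le] <;> constructor <;> linarith

theorem le_sub_of_le_clip_sub {M η a b : ℝ} (hη : 0 < η) (h : η ≤ clip M a - clip M b) :
    η ≤ a - b := by
  unfold clip at h
  rcases max_cases (-M) (min M a) with h1 | h1 <;> rcases min_cases M a with h2 | h2 <;>
    rcases max_cases (-M) (min M b) with h3 | h3 <;> rcases min_cases M b with h4 | h4 <;>
    linarith

theorem mul_sub_clip_le {q : ℝ} (hq : 0 < q) (g y : ℝ) :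
    g * (y - clip (q ^ 2) y) ≤ (y ^ 2 + g ^ 4) / q := by
  set z := |y - clip (q ^ 2) y| with hz
  have hz0 : 0 ≤ z := abs_nonneg _
  have hq2 : 0 < q ^ 2 := by positivity
  have hzy : z ≤ |y| ∧ z * q ^ 2 ≤ y ^ 2 := by
    rcases le_or_gt |y| (q ^ 2) with h | h
    · have h' := abs_le.1 h
      have : clip (q ^ 2) y = y := by
        rw [clip, min_eq_right h'.2, max_eq_right h'.1]
      rw [hz, this]
      simp only [sub_self, abs_zero, abs_nonneg, zero_mul, true_and]
      positivity
    · have hzz : z ≤ |y| := by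
        rw [hz]
        unfold clip
        rcases max_cases (-(q ^ 2)) (min (q ^ 2) y) with h1 | h1 <;>
          rcases min_cases (q ^ 2) y with h2 | h2 <;>
          rcases abs_cases y with h3 | h3 <;> rw [abs_le] <;> constructor <;> linarith
      refine ⟨hzz, ?_⟩
      rw [← sq_abs y, sq |y|]
      exact mul_le_mul hzz h.le hq2.le (abs_nonneg _)
  rw [le_div_iff₀ hq]
  have h1 : g * (y - clip (q ^ 2) y) ≤ |g| * z := by
    rw [hz, ← abs_mul]
    exact le_abs_self _
  have h2 : g * (y - clip (q ^ 2) y) * q ≤ |g| * z * q := by gcongr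
  refine h2.trans ?_
  have hg4 : |g| ^ 4 = g ^ 4 := by simp [Even.pow_abs (show Even 4 by decide)]
  rcases le_or_gt |g| q with h | h
  · have h3 : |g| * z * q ≤ q * z * q := by gcongr
    have h4 : 0 ≤ g ^ 4 := by positivity
    nlinarith [hzy.2]
  · have h3 : |g| * z * q ≤ |g| * |y| * |g| := by
      have := hzy.1
      gcongr
    have h4 : |y| ^ 2 = y ^ 2 := sq_abs y
    nlinarith [sq_nonneg (|g| ^ 2 - |y|), sq_nonneg (|g| ^ 2), sq_nonneg |y|]

end Truncation

section Banach

variable {X : Type*} [NormedAddCommGroup X] [NormedSpace ℝ X] {n : ℕ}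

/-- The truncated coordinate image of the dual unit ball. -/
def clippedDualBall (x : Fin n → X) (M : ℝ) : Set (Fin n → ℝ) :=
  {f | ∃ φ : StrongDual ℝ X, ‖φ‖ ≤ 1 ∧ f = fun i => clip M (φ (x i))}

theorem sum_sq_dual_le {x : Fin n → X}
    (hx : ∀ a : Fin n → ℝ, ‖∑ i, a i • x i‖ ≤ √n * √(∑ i, |a i| ^ 2))
    {φ : StrongDual ℝ X} (hφ : ‖φ‖ ≤ 1) : ∑ i, φ (x i) ^ 2 ≤ n := by
  have h1 := hx fun i => φ (x i)
  simp only [sq_abs] at h1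
  set S := ∑ i, φ (x i) ^ 2 with hS
  have hS0 : 0 ≤ S := Finset.sum_nonneg fun i _ => sq_nonneg _
  have h2 : S ≤ ‖∑ i, φ (x i) • x i‖ := by
    calc S = φ (∑ i, φ (x i) • x i) := by simp [hS, sq]
      _ ≤ ‖φ (∑ i, φ (x i) • x i)‖ := Real.le_norm_self _
      _ ≤ 1 * ‖∑ i, φ (x i) • x i‖ := φ.le_of_opNorm_le hφ _
      _ = _ := one_mul _
  have h3 := h2.trans h1
  have h4 : √S * √S = S := Real.mul_self_sqrt hS0
  have h5 : √(n : ℝ) * √n = n := Real.mul_self_sqrt (Nat.cast_nonneg n)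
  rcases (Real.sqrt_nonneg S).eq_or_lt with h | h
  · rw [← h4, ← h]
    simp
  · have h6 : √S ≤ √n := le_of_mul_le_mul_right (by linarith) h
    exact (Real.sqrt_le_sqrt_iff (Nat.cast_nonneg n)).1 h6

theorem integral_norm_le_card {x : Fin n → X}
    (hx : ∀ a : Fin n → ℝ, ‖∑ i, a i • x i‖ ≤ √n * √(∑ i, |a i| ^ 2)) :
    ∫ g : Fin n → ℝ, ‖∑ i, g i • x i‖ ∂(gaussPi n) ≤ n := by
  have hint : Integrable (fun g : Fin n → ℝ => ∑ i, g i ^ 2) (gaussPi n) :=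
    integrable_finsetSum _ fun i _ => integrable_pow_gaussPi 2 i
  have h := integral_mono_of_nonneg (μ := gaussPi n)
    (f := fun g : Fin n → ℝ => ‖∑ i, g i • x i‖)
    (g := fun g : Fin n → ℝ => ((n : ℝ) + ∑ i, g i ^ 2) / 2)
    (Filter.Eventually.of_forall fun g => norm_nonneg _)
    (((integrable_const _).add hint).div_const 2)
    (Filter.Eventually.of_forall fun g => by
      have h1 := hx g
      simp only [sq_abs] at h1
      have h2 : √(∑ i, g i ^ 2) ^ 2 = ∑ i, g i ^ 2 :=
        Real.sq_sqrt (Finset.sum_nonneg fun i _ => sq_nonneg _)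
      have h3 : √(n : ℝ) ^ 2 = n := Real.sq_sqrt (Nat.cast_nonneg n)
      dsimp only
      nlinarith [sq_nonneg (√(n : ℝ) - √(∑ i, g i ^ 2))])
  rw [integral_div, integral_add (integrable_const _) hint,
    integral_finsetSum _ fun i _ => integrable_pow_gaussPi 2 i] at h
  simp only [integral_sq_gaussPi, integral_const, probReal_univ, one_smul, Finset.sum_const,
    Finset.card_univ, Fintype.card_fin, nsmul_eq_mul, mul_one] at h
  linarith

/-- Truncated entropy bound for the Gaussian average of the norm. -/
theorem integral_norm_le_of_entropy (hn : 0 < n) {x : Fin n → X}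
    (hx : ∀ a : Fin n → ℝ, ‖∑ i, a i • x i‖ ≤ √n * √(∑ i, |a i| ^ 2))
    {q Q : ℝ} (hq : 0 < q) (hQ : 0 < Q) (m : ℕ)
    (hT : ∀ k ≤ m, ∀ A : Finset (Fin n → ℝ), ↑A ⊆ clippedDualBall x (q ^ 2) →
      (∀ f ∈ A, ∀ g ∈ A, f ≠ g → ((1 / 2 : ℝ) ^ k) ^ 2 * n ≤ ∑ i, (f i - g i) ^ 2) →
      Real.log A.card ≤ 4 ^ k * Q) :
    ∫ g : Fin n → ℝ, ‖∑ i, g i • x i‖ ∂(gaussPi n) ≤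
      4 * m * √(n * Q) + (1 / 2) ^ m * n + 81 * n / q := by
  obtain ⟨A, Φ, -, -, hA, hΦ, hΦA, hΦi⟩ := exists_chaining_majorant hn
    (clippedDualBall x (q ^ 2)) ⟨0, by simp, by
      funext i
      have : 0 ≤ q ^ 2 := by positivity
      simp [clip, this]⟩ (by
      rintro f ⟨φ, hφ, rfl⟩
      refine (Finset.sum_le_sum fun i _ => ?_).trans (sum_sq_dual_le hx hφ)
      exact sq_le_sq.2 (abs_clip_le_abs (by positivity) _)) hQ m hT
  set τ := (1 / 2 : ℝ) ^ m with hτ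
  have hτ0 : 0 < τ := by positivity
  have hint2 : Integrable (fun g : Fin n → ℝ => ∑ i, g i ^ 2) (gaussPi n) :=
    integrable_finsetSum _ fun i _ => integrable_pow_gaussPi 2 i
  have hint4 : Integrable (fun g : Fin n → ℝ => ∑ i, g i ^ 4) (gaussPi n) :=
    integrable_finsetSum _ fun i _ => integrable_pow_gaussPi 4 i
  have hI1 : Integrable (fun g : Fin n → ℝ => τ * ((∑ i, g i ^ 2) + n) / 2) (gaussPi n) :=
    ((hint2.add (integrable_const _)).const_mul _).div_const _
  have hI2 : Integrable (fun g : Fin n → ℝ => ((n : ℝ) + ∑ i, g i ^ 4) / q) (gaussPi n) :=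
    ((integrable_const _).add hint4).div_const _
  have h := integral_mono_of_nonneg (μ := gaussPi n)
    (f := fun g : Fin n → ℝ => ‖∑ i, g i • x i‖)
    (g := fun g : Fin n → ℝ => Φ g + τ * ((∑ i, g i ^ 2) + n) / 2 + ((n : ℝ) + ∑ i, g i ^ 4) / q)
    (Filter.Eventually.of_forall fun g => norm_nonneg _)
    ((hΦ.add hI1).add hI2)
    (Filter.Eventually.of_forall fun g => by
      dsimp only
      obtain ⟨φ, hφ, hφx⟩ := exists_dual_vector'' ℝ (∑ i, g i • x i)
      obtain ⟨u, hu, hfu⟩ := hA _ ⟨φ, hφ, rfl⟩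
      have h1 : ‖∑ i, g i • x i‖ = ∑ i, g i * φ (x i) := by
        simpa using hφx.symm
      have h2 : ∑ i, g i * φ (x i) = ∑ i, g i * u i +
          ∑ i, g i * (clip (q ^ 2) (φ (x i)) - u i) +
          ∑ i, g i * (φ (x i) - clip (q ^ 2) (φ (x i))) := by
        rw [← Finset.sum_add_distrib, ← Finset.sum_add_distrib]
        exact Finset.sum_congr rfl fun i _ => by ring
      have h3 : ∑ i, g i * (clip (q ^ 2) (φ (x i)) - u i) ≤ τ * ((∑ i, g i ^ 2) + n) / 2 := by
        have h4 : ∑ i, g i * (clip (q ^ 2) (φ (x i)) - u i) ≤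
            ∑ i, (τ / 2 * g i ^ 2 + 1 / (2 * τ) * (clip (q ^ 2) (φ (x i)) - u i) ^ 2) := by
          refine Finset.sum_le_sum fun i _ => ?_
          have h5 : τ / 2 * g i ^ 2 + 1 / (2 * τ) * (clip (q ^ 2) (φ (x i)) - u i) ^ 2 -
              g i * (clip (q ^ 2) (φ (x i)) - u i) =
              (τ * g i - (clip (q ^ 2) (φ (x i)) - u i)) ^ 2 / (2 * τ) := by
            field_simp
            ring
          have h6 : 0 ≤ (τ * g i - (clip (q ^ 2) (φ (x i)) - u i)) ^ 2 / (2 * τ) := by positivity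
          linarith
        rw [Finset.sum_add_distrib, ← Finset.mul_sum, ← Finset.mul_sum] at h4
        have h7 := mul_le_mul_of_nonneg_left hfu (show 0 ≤ 1 / (2 * τ) by positivity)
        have h8 : 1 / (2 * τ) * (τ ^ 2 * n) = τ * n / 2 := by field_simp
        linarith
      have h9 : ∑ i, g i * (φ (x i) - clip (q ^ 2) (φ (x i))) ≤ ((n : ℝ) + ∑ i, g i ^ 4) / q := by
        refine (Finset.sum_le_sum fun i _ => mul_sub_clip_le hq (g i) (φ (x i))).trans ?_
        rw [← Finset.sum_div, Finset.sum_add_distrib]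
        have := sum_sq_dual_le hx hφ
        gcongr
      have := hΦA u hu g
      linarith)
  refine h.trans ?_
  rw [integral_add (f := fun g => Φ g + _) (hΦ.add hI1) hI2, integral_add hΦ hI1, integral_div, integral_div,
    integral_const_mul, integral_add hint2 (integrable_const _),
    integral_add (integrable_const _) hint4,
    integral_finsetSum _ fun i _ => integrable_pow_gaussPi 2 i,
    integral_finsetSum _ fun i _ => integrable_pow_gaussPi 4 i]
  simp only [integral_sq_gaussPi, integral_const, probReal_univ, one_smul, Finset.sum_const,
    Finset.card_univ, Fintype.card_fin, nsmul_eq_mul, mul_one]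
  have h4 : ∑ i : Fin n, ∫ g : Fin n → ℝ, g i ^ 4 ∂(gaussPi n) ≤ n * 80 := by
    refine (Finset.sum_le_sum fun i _ => integral_pow_four_gaussPi_le i).trans ?_
    simp
  have h5 : ((n : ℝ) + ∑ i : Fin n, ∫ g : Fin n → ℝ, g i ^ 4 ∂(gaussPi n)) / q ≤ 81 * n / q := by
    gcongr
    linarith
  linarith

/-- A shattered coordinate set spans a copy of `ℓ₁`. -/
theorem mul_sum_abs_le_norm_of_shattered {x : Fin n → X} {M η : ℝ} (hη : 0 < η)
    {σ : Finset (Fin n)} {h : Fin n → ℝ}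
    (hsh : ∀ ε : Fin n → Bool, ∃ f ∈ clippedDualBall x M, ∀ i ∈ σ,
      (ε i = true → h i + η ≤ f i) ∧ (ε i = false → f i ≤ h i)) (a : Fin n → ℝ) :
    η / 2 * ∑ i ∈ σ, |a i| ≤ ‖∑ i ∈ σ, a i • x i‖ := by
  obtain ⟨_, ⟨φ, hφ, rfl⟩, H⟩ := hsh fun i => decide (0 ≤ a i)
  obtain ⟨_, ⟨ψ, hψ, rfl⟩, H'⟩ := hsh fun i => !decide (0 ≤ a i)
  have h1 : ∀ i ∈ σ, η * |a i| ≤ a i * (φ (x i) - ψ (x i)) := by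
    intro i hi
    by_cases ha : 0 ≤ a i
    · have h2 := (H i hi).1 (by simpa using ha)
      have h3 := (H' i hi).2 (by simpa using ha)
      have h4 := le_sub_of_le_clip_sub (M := M) (a := φ (x i)) (b := ψ (x i)) hη (by linarith)
      rw [abs_of_nonneg ha]
      nlinarith
    · have h2 := (H i hi).2 (by simpa using ha)
      have h3 := (H' i hi).1 (by simpa using ha)
      have h4 := le_sub_of_le_clip_sub (M := M) (a := ψ (x i)) (b := φ (x i)) hη (by linarith)
      rw [abs_of_neg (not_le.1 ha)]
      nlinarith
  have h2 := Finset.sum_le_sum h1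
  rw [← Finset.mul_sum] at h2
  have h3 : ∑ i ∈ σ, a i * (φ (x i) - ψ (x i)) =
      φ (∑ i ∈ σ, a i • x i) - ψ (∑ i ∈ σ, a i • x i) := by
    simp [mul_sub, Finset.sum_sub_distrib]
  have h4 := φ.le_of_opNorm_le hφ (∑ i ∈ σ, a i • x i)
  have h5 := ψ.le_of_opNorm_le hψ (∑ i ∈ σ, a i • x i)
  rw [Real.norm_eq_abs] at h4 h5
  have h6 := (abs_le.1 h4).2
  have h7 := (abs_le.1 h5).1
  linarith

end Banach

section Numerics

theorem half_lt_log_two_div {δ : ℝ} (h0 : 0 < δ) (h1 : δ ≤ 1) :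
    1 / 2 < Real.log 2 ∧ Real.log 2 ≤ Real.log (2 / δ) := by
  refine ⟨by linarith [Real.log_two_gt_d9], Real.log_le_log two_pos ?_⟩
  rw [le_div_iff₀ h0]
  linarith

theorem entropy_numeric_bound {δ s : ℝ} (h0 : 0 < δ) (h1 : δ ≤ 1) {k : ℕ}
    (hk : (2 : ℝ) ^ k ≤ 8 / δ) (hs : 0 < s)
    (hs2 : s ^ 2 = (1 / 100000) ^ 2 * δ ^ 2 * (2 ^ k) ^ 2 / Real.log (2 / δ) ^ 3) :
    s ^ 2 ≤ 20 * (400 / δ) ^ 2 * 2 ^ k + 1 ∧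
    2 * s ^ 2 * (1 + Real.log ((20 * (400 / δ) ^ 2 * 2 ^ k + 1) / s ^ 2)) ≤
      4 ^ k * (δ ^ 2 / (100 * Real.log (2 / δ)) ^ 2) := by
  obtain ⟨hl2, hl⟩ := half_lt_log_two_div h0 h1
  set l := Real.log (2 / δ) with hldef
  have hl0 : 0 < l := by linarith
  have hk1 : (1 : ℝ) ≤ 2 ^ k := one_le_pow₀ (by norm_num)
  have hk' : δ * 2 ^ k ≤ 8 := by
    rw [le_div_iff₀ h0] at hk
    linarith
  have hl3 : 1 / 8 ≤ l ^ 3 := by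
    calc (1 / 8 : ℝ) = (1 / 2) ^ 3 := by norm_num
      _ ≤ l ^ 3 := by gcongr; linarith
  constructor
  · have h2 : s ^ 2 ≤ 1 := by
      rw [hs2, div_le_one (by positivity)]
      have : (δ * 2 ^ k) ^ 2 ≤ 8 ^ 2 := by gcongr
      nlinarith
    have : 0 ≤ 20 * (400 / δ) ^ 2 * 2 ^ k := by positivity
    linarith
  · have hfrac : (20 * (400 / δ) ^ 2 * 2 ^ k + 1) / s ^ 2 ≤ 2 ^ 56 * l ^ 3 * (2 / δ) ^ 4 := by
      have hR : 20 * (400 / δ) ^ 2 * 2 ^ k + 1 ≤ 40 * (400 / δ) ^ 2 * 2 ^ k := by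
        have : (1 : ℝ) ≤ 400 / δ := by rw [le_div_iff₀ h0]; linarith
        have : (1 : ℝ) ≤ (400 / δ) ^ 2 := one_le_pow₀ this
        nlinarith
      rw [div_le_iff₀ (by positivity), hs2]
      refine hR.trans ?_
      have e1 : 2 ^ 56 * l ^ 3 * (2 / δ) ^ 4 *
          ((1 / 100000) ^ 2 * δ ^ 2 * (2 ^ k) ^ 2 / l ^ 3) =
          2 ^ 60 * (1 / 100000) ^ 2 * (2 ^ k) ^ 2 / δ ^ 2 := by
        field_simp
      have e2 : 40 * (400 / δ) ^ 2 * 2 ^ k = 6400000 * 2 ^ k / δ ^ 2 := by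
        field_simp
        norm_num
      rw [e1, e2]
      gcongr
      · norm_num
      · nlinarith
    have hlog : Real.log ((20 * (400 / δ) ^ 2 * 2 ^ k + 1) / s ^ 2) ≤ 63 * l := by
      refine (Real.log_le_log (by positivity) hfrac).trans ?_
      rw [Real.log_mul (by positivity) (by positivity), Real.log_mul (by positivity)
        (by positivity), Real.log_pow, Real.log_pow, Real.log_pow, ← hldef]
      have := Real.log_le_sub_one_of_pos hl0
      push_cast
      linarith
    have e4 : (4 : ℝ) ^ k = (2 ^ k) ^ 2 := by
      rw [← pow_mul, mul_comm, pow_mul]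
      norm_num
    calc 2 * s ^ 2 * (1 + Real.log ((20 * (400 / δ) ^ 2 * 2 ^ k + 1) / s ^ 2))
        ≤ 2 * s ^ 2 * (65 * l) := by
          gcongr
          linarith
      _ = 130 * (1 / 100000) ^ 2 * ((2 ^ k) ^ 2 * δ ^ 2 / l ^ 2) := by
          rw [hs2]
          field_simp
          norm_num
      _ ≤ (1 / 100) ^ 2 * ((2 ^ k) ^ 2 * δ ^ 2 / l ^ 2) := by
          gcongr
          norm_num
      _ = 4 ^ k * (δ ^ 2 / (100 * l) ^ 2) := by
          rw [e4]
          field_simp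

end Numerics

/-- Let `n ≥ 1` and let `x₁,…,x_n` be vectors in a real Banach space with
`‖Σ aᵢ xᵢ‖ ≤ √n·(Σ |aᵢ|²)^{1/2}` for all real scalars and `𝔼‖Σ gᵢ xᵢ‖ ≥ δ n` for some `δ > 0`.
Then there are `s > 0` and `cδ ≤ t ≤ 1` with `s·t ≥ c·δ/(log(2/δ))^{3/2}` and a subset
`σ ⊆ {1,…,n}` with `|σ| ≥ s²·n` such that `‖Σ_{i∈σ} aᵢ xᵢ‖ ≥ c·t·Σ_{i∈σ} |aᵢ|` for all
real scalars `(aᵢ)`, where `c > 0` is an absolute constant. -/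
theorem coordinate_subset_l1_separation :
    ∃ c : ℝ, 0 < c ∧ ∀ (X : Type*) [NormedAddCommGroup X] [NormedSpace ℝ X] [CompleteSpace X]
      (n : ℕ) (x : Fin n → X) (δ : ℝ), 0 < n → 0 < δ →
      (∀ a : Fin n → ℝ, ‖∑ i, a i • x i‖ ≤ Real.sqrt n * Real.sqrt (∑ i, |a i| ^ 2)) →
      δ * n ≤ ∫ g : Fin n → ℝ, ‖∑ i, g i • x i‖ ∂(gaussPi n) →
      ∃ s t : ℝ, 0 < s ∧ c * δ ≤ t ∧ t ≤ 1 ∧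
        c * δ / (Real.log (2 / δ)) ^ (3 / 2 : ℝ) ≤ s * t ∧
        ∃ σ : Finset (Fin n), s ^ 2 * n ≤ (σ.card : ℝ) ∧
          ∀ a : Fin n → ℝ, c * t * ∑ i ∈ σ, |a i| ≤ ‖∑ i ∈ σ, a i • x i‖ := by
  refine ⟨1 / 100000, by norm_num, ?_⟩
  intro X _ _ _ n x δ hn hδ hx hE
  have hn' : (0 : ℝ) < n := by exact_mod_cast hn
  have hδ1 : δ ≤ 1 := by
    have := hE.trans (integral_norm_le_card hx)
    nlinarith
  obtain ⟨hl2, hl⟩ := half_lt_log_two_div hδ hδ1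
  set l := Real.log (2 / δ) with hldef
  have hl0 : 0 < l := by linarith
  set w := l ^ (3 / 2 : ℝ) with hw
  have hw0 : 0 < w := Real.rpow_pos_of_pos hl0 _
  have hw2 : w ^ 2 = l ^ 3 := by
    rw [hw, ← Real.rpow_natCast, ← Real.rpow_mul hl0.le, ← Real.rpow_natCast]
    norm_num
  obtain ⟨m', hm1, hm2⟩ := exists_nat_pow_near (x := 4 / δ) (y := (2 : ℝ))
    (by rw [le_div_iff₀ hδ]; linarith) (by norm_num)
  set m := m' + 1 with hm
  have hm8 : (2 : ℝ) ^ m ≤ 8 / δ := by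
    rw [hm, pow_succ]
    have : 8 / δ = 4 / δ * 2 := by ring
    rw [this]
    gcongr
  by_contra hcon
  have hent : ∀ k ≤ m, ∀ A : Finset (Fin n → ℝ), ↑A ⊆ clippedDualBall x ((400 / δ) ^ 2) →
      (∀ f ∈ A, ∀ g ∈ A, f ≠ g → ((1 / 2 : ℝ) ^ k) ^ 2 * n ≤ ∑ i, (f i - g i) ^ 2) →
      Real.log A.card ≤ 4 ^ k * (n * (δ ^ 2 / (100 * l) ^ 2)) := by
    intro k hk A hA hsep
    have : Nonempty (Fin n) := ⟨⟨0, hn⟩⟩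
    have hk8 : (2 : ℝ) ^ k ≤ 8 / δ :=
      (pow_le_pow_right₀ (by norm_num) hk).trans hm8
    set s := 1 / 100000 * δ * 2 ^ k / w with hs
    have hs0 : 0 < s := by positivity
    have hs2 : s ^ 2 = (1 / 100000) ^ 2 * δ ^ 2 * (2 ^ k) ^ 2 / l ^ 3 := by
      rw [hs, div_pow, hw2, mul_pow, mul_pow]
    obtain ⟨hsR, hnum⟩ := entropy_numeric_bound hδ hδ1 hk8 hs0 hs2
    have h2k : (1 / 2 : ℝ) ^ k * 2 ^ k = 1 := by rw [← mul_pow]; norm_num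
    have ht0 : (0 : ℝ) < (1 / 2) ^ k := by positivity
    have hlog := log_card_le_of_not_shattered (fun f : Fin n → ℝ => f) A
      (M := (400 / δ) ^ 2) (t := (1 / 2) ^ k) (V := s ^ 2 * n)
      (R := 20 * (400 / δ) ^ 2 * 2 ^ k + 1) ht0 (by positivity)
      (by positivity) (by
        rw [one_div, inv_pow, div_inv_eq_mul]) (by
        rw [Fintype.card_fin]
        gcongr) (by
        intro f hf i
        obtain ⟨φ, _, rfl⟩ := hA hf
        exact abs_clip_le (by positivity) _) (by simpa using hsep) (by
        rintro σ hσ ⟨h, hh⟩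
        refine hcon ⟨s, (1 / 2) ^ k, hs0, ?_, pow_le_one₀ (by norm_num) (by norm_num), ?_,
          σ, hσ, fun a => ?_⟩
        · rw [le_div_iff₀ hδ] at hk8
          nlinarith
        · have : s * (1 / 2) ^ k = 1 / 100000 * δ / w := by
            rw [hs]
            linear_combination (1 / 100000 * δ / w) * h2k
          rw [this]
        · have h1 := mul_sum_abs_le_norm_of_shattered (x := x) (M := (400 / δ) ^ 2)
            (η := (1 / 2) ^ k / 10) (by positivity) (σ := σ) (h := h) (fun ε =>
              let ⟨f, hf, H⟩ := hh ε
              ⟨f, hA hf, H⟩) a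
          refine le_trans ?_ h1
          have : 0 ≤ ∑ i ∈ σ, |a i| := Finset.sum_nonneg fun i _ => abs_nonneg _
          gcongr
          linarith)
    have hdiv : (20 * (400 / δ) ^ 2 * 2 ^ k + 1) * (Fintype.card (Fin n) : ℝ) / (s ^ 2 * n) =
        (20 * (400 / δ) ^ 2 * 2 ^ k + 1) / s ^ 2 := by
      rw [Fintype.card_fin, mul_div_mul_right _ _ hn'.ne']
    rw [hdiv] at hlog
    have := mul_le_mul_of_nonneg_left hnum hn'.le
    linarith
  have hbound := integral_norm_le_of_entropy hn hx (q := 400 / δ) (by positivity)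
    (by positivity) m hent
  have hsqrt : √((n : ℝ) * (n * (δ ^ 2 / (100 * l) ^ 2))) = n * δ / (100 * l) := by
    rw [show (n : ℝ) * (n * (δ ^ 2 / (100 * l) ^ 2)) = (n * δ / (100 * l)) ^ 2 by ring]
    exact Real.sqrt_sq (by positivity)
  have hml : (m : ℝ) ≤ 6 * l := by
    have h1 := Real.log_le_log (by positivity) hm8
    rw [Real.log_pow, show 8 / δ = 2 ^ 2 * (2 / δ) by ring, Real.log_mul (by positivity)
      (by positivity), Real.log_pow, ← hldef] at h1
    push_cast at h1
    have h2 : (0 : ℝ) ≤ m := Nat.cast_nonneg m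
    nlinarith
  have hterm1 : 4 * (m : ℝ) * (n * δ / (100 * l)) ≤ 24 / 100 * (δ * n) := by
    calc 4 * (m : ℝ) * (n * δ / (100 * l)) ≤ 4 * (6 * l) * (n * δ / (100 * l)) := by gcongr
      _ = 24 / 100 * (δ * n) := by field_simp; norm_num
  have hterm2 : (1 / 2 : ℝ) ^ m * n ≤ 1 / 4 * (δ * n) := by
    have h1 : (1 / 2 : ℝ) ^ m ≤ δ / 4 := by
      rw [one_div, inv_pow, inv_le_comm₀ (by positivity) (by positivity), inv_div]
      exact hm2.le
    nlinarith
  have hterm3 : 81 * (n : ℝ) / (400 / δ) = 81 / 400 * (δ * n) := by field_simp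
  rw [hsqrt, hterm3] at hbound
  have : 0 < δ * n := by positivity
  linarith
end
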